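/- arXiv:nlin/0312025 — 12 statements merged into one kernel-verified Lean document; each statement's English description precedes it below -/
import Mathlib

section
/- Let R be a commutative ring, ρ_0 = 1, ρ_1, …, ρ_n ∈ R with ρ_n a unit, and p(X) := X^n + ρ_1X^{n−1} + ⋯ + ρ_n ∈ R[X]. Define the inverse basic separable potentials V_r^{(−m)} (1 ≤ r ≤ n, m ≥ 0) by V_r^{(0)} := −δ_{r,n} and the recursion V_r^{(−m−1)} := V_{r−1}^{(−m)} − (ρ_{r−1}/ρ_n)·V_n^{(−m)} (with the convention V_0^{(−m)} := 0). Then for every m ≥ 0, the polynomial p(X) divides 1 + X^m·(Σ_{r=1}^{n} V_r^{(−m)} X^{n−r}) in R[X]; in particular V_r^{(−1)} = ρ_{r−1}/ρ_n. -/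
open Polynomial

theorem ibsp_sum_Icc {M : Type*} [AddCommMonoid M] (f : ℕ → M) (n : ℕ) :
    ∑ r ∈ Finset.Icc 1 n, f r = ∑ i ∈ Finset.range n, f (i + 1) := by
  induction n with
  | zero => simp
  | succ k ih => rw [Finset.sum_Icc_succ_top (by omega), ih, Finset.sum_range_succ]

/-- Let `R` be a commutative ring, `ρ 0 = 1, ρ 1, …, ρ n ∈ R` with
`ρ n` a unit (with inverse `u`), and `p = X^n + ρ 1 * X^(n-1) + ⋯ + ρ n`.  Define the
inverse basic separable potentials `W m r` (`W m r` is `V_r^{(-m)}`, `1 ≤ r ≤ n`,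
`m ≥ 0`) by `W 0 r = -δ_{r,n}` and the recursion
`W (m+1) r = W m (r-1) - (ρ (r-1) * u) * W m n` with the convention `W m 0 = 0`.
Then for every `m`, `p` divides `1 + X^m * (∑_{r=1}^{n} W m r * X^(n-r))`;
in particular `W 1 r = ρ (r-1) * u`. -/
theorem inverse_basic_separable_potentials_generating_equation
    {R : Type*} [CommRing R] {n : ℕ} (hn : 1 ≤ n)
    (ρ : ℕ → R) (hρ0 : ρ 0 = 1) (u : R) (hu : ρ n * u = 1)
    (p : R[X]) (hp : p = X ^ n + ∑ r ∈ Finset.Icc 1 n, Polynomial.C (ρ r) * X ^ (n - r))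
    (W : ℕ → ℕ → R)
    (hW0 : ∀ r ∈ Finset.Icc 1 n, W 0 r = -(if r = n then 1 else 0))
    (hWbot : ∀ m, W m 0 = 0)
    (hWrec : ∀ m, ∀ r ∈ Finset.Icc 1 n, W (m + 1) r = W m (r - 1) - ρ (r - 1) * u * W m n) :
    (∀ m, p ∣ 1 + X ^ m * ∑ r ∈ Finset.Icc 1 n, Polynomial.C (W m r) * X ^ (n - r))
      ∧ (∀ r ∈ Finset.Icc 1 n, W 1 r = ρ (r - 1) * u) := by
  have hp' : p = ∑ s ∈ Finset.range (n + 1), Polynomial.C (ρ s) * X ^ (n - s) := by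
    rw [hp, ibsp_sum_Icc, Finset.sum_range_succ', add_comm]
    simp [hρ0]
  have hS : ∀ m, ∑ r ∈ Finset.Icc 1 n, Polynomial.C (W m r) * X ^ (n - r)
      = ∑ s ∈ Finset.range (n + 1), Polynomial.C (W m s) * X ^ (n - s) := by
    intro m
    rw [ibsp_sum_Icc, Finset.sum_range_succ']
    simp [hWbot]
  have key : ∀ m, X * ∑ r ∈ Finset.Icc 1 n, Polynomial.C (W (m + 1) r) * X ^ (n - r)
      = (∑ r ∈ Finset.Icc 1 n, Polynomial.C (W m r) * X ^ (n - r))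
        - Polynomial.C (u * W m n) * p := by
    intro m
    rw [hS m, hp', Finset.mul_sum, Finset.mul_sum, ← Finset.sum_sub_distrib, ibsp_sum_Icc,
      Finset.sum_range_succ]
    have h0 : Polynomial.C (W m n) * X ^ (n - n)
        - Polynomial.C (u * W m n) * (Polynomial.C (ρ n) * X ^ (n - n)) = 0 := by
      rw [← mul_assoc, ← Polynomial.C_mul, ← sub_mul, ← Polynomial.C_sub]
      have : W m n - u * W m n * ρ n = 0 := by linear_combination (-W m n) * hu
      rw [this]; simp
    rw [h0, add_zero]
    refine Finset.sum_congr rfl fun s hs => ?_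
    have hs' := Finset.mem_range.1 hs
    rw [hWrec m (s + 1) (Finset.mem_Icc.2 ⟨by omega, by omega⟩), Nat.add_sub_cancel]
    have : n - s = (n - (s + 1)) + 1 := by omega
    rw [this, pow_succ]
    simp only [Polynomial.C_sub, Polynomial.C_mul]
    ring
  refine ⟨fun m => ?_, fun r hr => ?_⟩
  · induction m with
    | zero =>
      have : ∑ r ∈ Finset.Icc 1 n, Polynomial.C (W 0 r) * X ^ (n - r) = (-1 : R[X]) := by
        rw [Finset.sum_eq_single_of_mem n (Finset.mem_Icc.2 ⟨hn, le_rfl⟩)]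
        · rw [hW0 n (Finset.mem_Icc.2 ⟨hn, le_rfl⟩)]; simp
        · intro b hb hbn
          rw [hW0 b hb]; simp [hbn]
      rw [this]; simp
    | succ m ih =>
      rw [pow_succ, mul_assoc, key, mul_sub, ← add_sub_assoc]
      exact dvd_sub ih (Dvd.intro_left (X ^ m * Polynomial.C (u * W m n)) (by ring))
  · have h := Finset.mem_Icc.1 hr
    have h1 := hWrec 0 r hr
    rw [hW0 n (Finset.mem_Icc.2 ⟨hn, le_rfl⟩)] at h1
    have h2 : W 0 (r - 1) = 0 := by
      rcases Nat.eq_zero_or_pos (r - 1) with h3 | h3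
      · rw [h3, hWbot]
      · rw [hW0 (r - 1) (Finset.mem_Icc.2 ⟨h3, by omega⟩), if_neg (by omega), neg_zero]
    rw [h2] at h1
    simpa using h1
end

section
/- Let S be a commutative ring, ℓ ∈ S, and ρ_0 = 1, ρ_1, …, ρ_n ∈ S with the convention ρ_j := 0 for j < 0 and j > n. Define K_r := Σ_{j=0}^{r−1} ρ_j ℓ^{r−1−j} for r ≥ 1, K_0 := 0. Fix an integer n_1 with 2 ≤ n_1 ≤ n and assume K_{n_1−1} and ρ_{n_1−1} are units in S. Define K̃_r := K_r − K_{r−1} K_{n_1} K_{n_1−1}^{−1}, α_r := ρ_r − ρ_{r−1} ρ_{n_1} ρ_{n_1−1}^{−1}, and β_r := ρ_{r−1} ρ_{n_1−1}^{−1}. Then K̃_{n_1} = 0 and for all r ≥ 1: K̃_{r+1} = ℓ·K̃_r + α_r + β_r·K̃_{n_1+1}. -/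
/-- Let `S` be a commutative ring, `ℓ ∈ S`, `ρ 0 = 1, ρ 1, …, ρ n ∈ S`
extended by `ρ j = 0` for `j > n`, and `K r = ∑_{j=0}^{r-1} ρ j * ℓ^(r-1-j)` (`K 0 = 0`).
Fix `2 ≤ n₁ ≤ n` and assume `K (n₁ - 1)` and `ρ (n₁ - 1)` are units, with inverses `u`
and `v` respectively.  Define the one-hole deformed quantities
`K' r = K r - K (r-1) * K n₁ * u`, `α r = ρ r - ρ (r-1) * ρ n₁ * v`, and
`β r = ρ (r-1) * v`.  Then `K' n₁ = 0` and for all `r ≥ 1`: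
`K' (r+1) = ℓ * K' r + α r + β r * K' (n₁ + 1)`. -/
theorem one_hole_deformed_killing_tensor_recursion
    {S : Type*} [CommRing S] {n : ℕ} (ℓ : S)
    (ρ : ℕ → S) (hρ0 : ρ 0 = 1) (hρtop : ∀ j, n < j → ρ j = 0)
    (K : ℕ → S) (hK : ∀ r, K r = ∑ j ∈ Finset.range r, ρ j * ℓ ^ (r - 1 - j))
    (n₁ : ℕ) (hn₁ : 2 ≤ n₁) (hn₁' : n₁ ≤ n)
    (u v : S) (hu : K (n₁ - 1) * u = 1) (hv : ρ (n₁ - 1) * v = 1)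
    (K' α β : ℕ → S)
    (hK' : ∀ r, K' r = K r - K (r - 1) * K n₁ * u)
    (hα : ∀ r, α r = ρ r - ρ (r - 1) * ρ n₁ * v)
    (hβ : ∀ r, β r = ρ (r - 1) * v) :
    K' n₁ = 0 ∧ ∀ r, 1 ≤ r → K' (r + 1) = ℓ * K' r + α r + β r * K' (n₁ + 1) := by
  have hrec : ∀ r, K (r + 1) = ℓ * K r + ρ r := by
    intro r
    rw [hK (r + 1), hK r, Finset.sum_range_succ, Finset.mul_sum]
    congr 1
    · apply Finset.sum_congr rfl
      intro j hj
      have hj' := Finset.mem_range.mp hj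
      have e : r + 1 - 1 - j = (r - 1 - j) + 1 := by omega
      rw [e, pow_succ]
      ring
    · simp
  obtain ⟨m, rfl⟩ : ∃ m, n₁ = m + 1 := ⟨n₁ - 1, by omega⟩
  simp only [Nat.add_sub_cancel] at hu hv
  constructor
  · rw [hK', Nat.add_sub_cancel]
    linear_combination (-K (m + 1)) * hu
  · intro r hr
    obtain ⟨s, rfl⟩ : ∃ s, r = s + 1 := ⟨r - 1, by omega⟩
    rw [hK', hK', hK', hα, hβ]
    simp only [Nat.add_sub_cancel]
    rw [hrec (s + 1), hrec s, hrec (m + 1), hrec m]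
    linear_combination (ρ s * (ℓ * K m + ρ m) * u) * hv
      + (ρ s * v * (ℓ * K m + ρ m) * ℓ) * hu
end

section
/- Let n ≥ 2 and fix an integer n_1 with 2 ≤ n_1 ≤ n. Let E_1, …, E_n : ℝ^n × ℝ^n → ℝ be smooth functions and let ρ_1, …, ρ_n : ℝ^n × ℝ^n → ℝ be smooth functions depending only on the q-variables, with ρ_{n_1−1} nowhere vanishing; set E_0 := 0 and ρ_0 := 1. Assume {E_r, E_s} = 0 for all r, s and {E_r, ρ_s} = {E_s, ρ_r} for all r, s, where {·,·} is the canonical Poisson bracket. Define Ẽ_{r+1} := E_r − (ρ_r/ρ_{n_1−1})·E_{n_1−1} for r = 0, 1, …, n. Then {Ẽ_r, Ẽ_s} = 0 for all r, s ∈ {1, …, n+1}. -/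
open ContDiff

/-- The canonical Poisson bracket of two functions on `ℝ^n × ℝ^n` (coordinates `(q, p)`):
`{F, G} = ∑ i (∂F/∂q^i · ∂G/∂p_i − ∂F/∂p_i · ∂G/∂q^i)`. -/
noncomputable def poissonBracket {n : ℕ} (F G : ((Fin n → ℝ) × (Fin n → ℝ)) → ℝ) :
    ((Fin n → ℝ) × (Fin n → ℝ)) → ℝ :=
  fun x => ∑ i : Fin n,
    (fderiv ℝ F x (Pi.single i 1, 0) * fderiv ℝ G x (0, Pi.single i 1)
      - fderiv ℝ F x (0, Pi.single i 1) * fderiv ℝ G x (Pi.single i 1, 0))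

/-- The Poisson form on covectors. -/
noncomputable def pB {n : ℕ} (L M : ((Fin n → ℝ) × (Fin n → ℝ)) →L[ℝ] ℝ) : ℝ :=
  ∑ i : Fin n, (L (Pi.single i 1, 0) * M (0, Pi.single i 1)
      - L (0, Pi.single i 1) * M (Pi.single i 1, 0))

theorem pB_anti {n : ℕ} (L M : ((Fin n → ℝ) × (Fin n → ℝ)) →L[ℝ] ℝ) : pB L M = - pB M L := by
  unfold pB
  rw [← Finset.sum_neg_distrib]
  exact Finset.sum_congr rfl fun i _ => by ring

theorem pB_comb {n : ℕ} (A B C D M : ((Fin n → ℝ) × (Fin n → ℝ)) →L[ℝ] ℝ) (b c d : ℝ) :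
    pB (A + b • B + c • C + d • D) M = pB A M + b * pB B M + c * pB C M + d * pB D M := by
  unfold pB
  simp only [Finset.mul_sum, ← Finset.sum_add_distrib]
  refine Finset.sum_congr rfl fun i _ => ?_
  simp only [add_apply, smul_apply, smul_eq_mul]
  ring

theorem pB_comb' {n : ℕ} (A B C D M : ((Fin n → ℝ) × (Fin n → ℝ)) →L[ℝ] ℝ) (b c d : ℝ) :
    pB M (A + b • B + c • C + d • D) = pB M A + b * pB M B + c * pB M C + d * pB M D := by
  rw [pB_anti, pB_comb, pB_anti M A, pB_anti M B, pB_anti M C, pB_anti M D]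
  ring

/-- Let `n ≥ 2` and `2 ≤ n₁ ≤ n`.  Let `E 1, …, E n` be smooth functions
on `ℝ^n × ℝ^n` and `ρ 1, …, ρ n` smooth functions depending only on the `q`-variables,
with `ρ (n₁ - 1)` nowhere vanishing; set `E 0 = 0`, `ρ 0 = 1`.  If `{E r, E s} = 0` and
`{E r, ρ s} = {E s, ρ r}` for all `r, s`, then the one-hole deformed Hamiltonians
`Et (r+1) = E r - (ρ r / ρ (n₁ - 1)) * E (n₁ - 1)` (`r = 0, …, n`) are in involution:
`{Et r, Et s} = 0` for all `r, s ∈ {1, …, n+1}`. -/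
theorem one_hole_deformed_geodesic_hamiltonians_in_involution
    {n : ℕ} (hn : 2 ≤ n) (n₁ : ℕ) (hn₁ : 2 ≤ n₁) (hn₁' : n₁ ≤ n)
    (E ρ : ℕ → ((Fin n → ℝ) × (Fin n → ℝ)) → ℝ)
    (hEsmooth : ∀ r, 1 ≤ r → r ≤ n → ContDiff ℝ ∞ (E r))
    (hρsmooth : ∀ r, 1 ≤ r → r ≤ n → ContDiff ℝ ∞ (ρ r))
    (hρq : ∀ r, 1 ≤ r → r ≤ n → ∀ q p p', ρ r (q, p) = ρ r (q, p'))
    (hρne : ∀ x, ρ (n₁ - 1) x ≠ 0)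
    (hE0 : E 0 = 0) (hρ0 : ρ 0 = fun _ => 1)
    (hinv : ∀ r s, r ≤ n → s ≤ n → poissonBracket (E r) (E s) = 0)
    (hcompat : ∀ r s, r ≤ n → s ≤ n →
      poissonBracket (E r) (ρ s) = poissonBracket (E s) (ρ r))
    (Et : ℕ → ((Fin n → ℝ) × (Fin n → ℝ)) → ℝ)
    (hEt : ∀ r ≤ n, Et (r + 1) = fun x => E r x - ρ r x / ρ (n₁ - 1) x * E (n₁ - 1) x) :
    ∀ r s, 1 ≤ r → r ≤ n + 1 → 1 ≤ s → s ≤ n + 1 →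
      poissonBracket (Et r) (Et s) = 0 := by
  have hm1 : 1 ≤ n₁ - 1 := by omega
  have hmn : n₁ - 1 ≤ n := by omega
  generalize n₁ - 1 = m at *
  have hE : ∀ r ≤ n, Differentiable ℝ (E r) := by
    intro r hr
    rcases Nat.eq_zero_or_pos r with rfl | h
    · rw [hE0]; exact differentiable_const 0
    · exact (hEsmooth r h hr).differentiable (by simp)
  have hR : ∀ r ≤ n, Differentiable ℝ (ρ r) := by
    intro r hr
    rcases Nat.eq_zero_or_pos r with rfl | h
    · rw [hρ0]; exact differentiable_const 1
    · exact (hρsmooth r h hr).differentiable (by simp)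
  have hq : ∀ r ≤ n, ∀ q p p', ρ r (q, p) = ρ r (q, p') := by
    intro r hr
    rcases Nat.eq_zero_or_pos r with rfl | h
    · simp [hρ0]
    · exact hρq r h hr
  have hdp : ∀ r ≤ n, ∀ x v, fderiv ℝ (ρ r) x (0, v) = 0 := by
    intro r hr x v
    have h1 : ρ r = (fun q => ρ r (q, 0)) ∘ Prod.fst := by
      funext y
      exact hq r hr y.1 y.2 0
    have hd : Differentiable ℝ (fun q : Fin n → ℝ => ρ r (q, 0)) := by
      have := hR r hr
      fun_prop
    rw [h1, fderiv_comp x (hd _) differentiableAt_fst, fderiv_fst]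
    simp
  intro r s hr1 hrn hs1 hsn
  obtain ⟨r, rfl⟩ : ∃ k, r = k + 1 := ⟨r - 1, by omega⟩
  obtain ⟨s, rfl⟩ : ∃ k, s = k + 1 := ⟨s - 1, by omega⟩
  have hr : r ≤ n := by omega
  have hs : s ≤ n := by omega
  funext x
  have key : ∀ t ≤ n, fderiv ℝ (Et (t + 1)) x = fderiv ℝ (E t) x
      + (-(ρ t x / ρ m x)) • fderiv ℝ (E m) x
      + (-(E m x / ρ m x)) • fderiv ℝ (ρ t) x
      + (E m x * ρ t x / (ρ m x) ^ 2) • fderiv ℝ (ρ m) x := by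
    intro t ht
    rw [hEt t ht]
    have h := ((hE t ht) x).hasFDerivAt.sub
      ((((hR t ht) x).hasFDerivAt.mul
        ((hasDerivAt_inv (hρne x)).comp_hasFDerivAt x ((hR m hmn) x).hasFDerivAt)).mul
        ((hE m hmn) x).hasFDerivAt)
    have h' := h.fderiv
    have h2 : (fun x => E t x - ρ t x / ρ m x * E m x)
      = (E t - ρ t * (Inv.inv ∘ ρ m) * E m) := by
      funext y; simp [div_eq_mul_inv]
    rw [h2, h']
    have hne := hρne x
    ext v <;>
    · simp
      field_simp
      ring
  have e : ∀ F G, poissonBracket F G x = pB (fderiv ℝ F x) (fderiv ℝ G x) := fun _ _ => rfl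
  have i : ∀ a b, a ≤ n → b ≤ n → pB (fderiv ℝ (E a) x) (fderiv ℝ (E b) x) = 0 := by
    intro a b ha hb
    rw [← e, hinv a b ha hb]; rfl
  have c : ∀ a b, a ≤ n → b ≤ n → pB (fderiv ℝ (E a) x) (fderiv ℝ (ρ b) x)
      = pB (fderiv ℝ (E b) x) (fderiv ℝ (ρ a) x) := by
    intro a b ha hb
    rw [← e, ← e, hcompat a b ha hb]
  have z : ∀ a b, a ≤ n → b ≤ n → pB (fderiv ℝ (ρ a) x) (fderiv ℝ (ρ b) x) = 0 := by
    intro a b ha hb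
    simp [pB, hdp a ha, hdp b hb]
  have w : ∀ a b, pB (fderiv ℝ (ρ a) x) (fderiv ℝ (E b) x)
      = - pB (fderiv ℝ (E b) x) (fderiv ℝ (ρ a) x) := fun a b => pB_anti _ _
  rw [e, key r hr, key s hs, pB_comb]
  simp only [pB_comb', w, i r s hr hs, i r m hr hmn, i m s hmn hs, i m m hmn hmn,
    z r s hr hs, z r m hr hmn, z m s hmn hs, z m m hmn hmn,
    c r m hr hmn, c s m hs hmn, c s r hs hr]
  have := hρne x
  simp only [Pi.zero_apply]
  field_simp
  ring
end

section
/- Let n ≥ 1 and M ≥ 1. Let H̃_1, …, H̃_M : ℝ^n × ℝ^n → ℝ be smooth functions with {H̃_r, H̃_s} = 0 for all r, s, and let W_1, …, W_M : ℝ^n × ℝ^n → ℝ be smooth functions depending only on the q-variables such that {H̃_r, W_s} = {H̃_s, W_r} for all r, s, where {·,·} is the canonical Poisson bracket. Fix an index m ∈ {1,…,M} with W_m nowhere vanishing, set H̃_0 := 0 and W_0 := 1, and define H̄_{r+1} := H̃_r − (W_r/W_m)·H̃_m for r = 0, 1, …, M. Then {H̄_r, H̄_s} = 0 for all r, s ∈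 {1, …, M+1}. (This is the inductive step proving that the (k+1)-hole deformed Hamiltonians H̄_{r+1} = H̃_r − (Ṽ_r^{(n+k)}/Ṽ_{n_{k+1}−1}^{(n+k)}) H̃_{n_{k+1}−1} are in involution whenever the k-hole Hamiltonians are.) -/
open ContDiff

theorem fderiv_Hb_aux {E : Type*} [NormedAddCommGroup E] [NormedSpace ℝ E]
    (A B C D : E → ℝ) (x : E) (hA : DifferentiableAt ℝ A x) (hB : DifferentiableAt ℝ B x)
    (hC : DifferentiableAt ℝ C x) (hD : DifferentiableAt ℝ D x) (h0 : C x ≠ 0) (v : E) :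
    fderiv ℝ (fun x => A x - B x / C x * D x) x v =
      fderiv ℝ A x v - B x / C x * fderiv ℝ D x v
        - D x / (C x)^2 * (fderiv ℝ B x v * C x - B x * fderiv ℝ C x v) := by
  have h := hA.hasFDerivAt.sub ((hB.hasFDerivAt.mul ((hasDerivAt_inv h0).comp_hasFDerivAt x hC.hasFDerivAt)).mul hD.hasFDerivAt)
  have e : fderiv ℝ (fun x => A x - B x / C x * D x) x = _ := h.fderiv
  rw [e]
  simp [-neg_mul]
  field_simp
  ring

/-- (Inductive step for involutivity of hole-deformed Hamiltonians.)
Let `H 1, …, H M` be smooth functions on `ℝ^n × ℝ^n` in involution, and let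
`W 1, …, W M` be smooth functions of the `q`-variables only with
`{H r, W s} = {H s, W r}` for all `r, s`.  Fix `m ∈ {1, …, M}` with `W m`
nowhere vanishing, set `H 0 = 0`, `W 0 = 1`, and define
`Hb (r+1) = H r - (W r / W m) * H m` for `r = 0, …, M`.  Then
`{Hb r, Hb s} = 0` for all `r, s ∈ {1, …, M+1}`. -/
theorem deformed_hamiltonians_involution_inductive_step
    {n M : ℕ} (hn : 1 ≤ n) (hM : 1 ≤ M)
    (H W : ℕ → ((Fin n → ℝ) × (Fin n → ℝ)) → ℝ)
    (hHsmooth : ∀ r, 1 ≤ r → r ≤ M → ContDiff ℝ ∞ (H r))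
    (hWsmooth : ∀ r, 1 ≤ r → r ≤ M → ContDiff ℝ ∞ (W r))
    (hWq : ∀ r, 1 ≤ r → r ≤ M → ∀ q p p', W r (q, p) = W r (q, p'))
    (hinv : ∀ r s, r ≤ M → s ≤ M → poissonBracket (H r) (H s) = 0)
    (hcompat : ∀ r s, r ≤ M → s ≤ M →
      poissonBracket (H r) (W s) = poissonBracket (H s) (W r))
    (m : ℕ) (hm : 1 ≤ m) (hm' : m ≤ M) (hWne : ∀ x, W m x ≠ 0)
    (hH0 : H 0 = 0) (hW0 : W 0 = fun _ => 1)
    (Hb : ℕ → ((Fin n → ℝ) × (Fin n → ℝ)) → ℝ)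
    (hHb : ∀ r ≤ M, Hb (r + 1) = fun x => H r x - W r x / W m x * H m x) :
    ∀ r s, 1 ≤ r → r ≤ M + 1 → 1 ≤ s → s ≤ M + 1 →
      poissonBracket (Hb r) (Hb s) = 0 := by
  have hHd : ∀ r ≤ M, ∀ x, DifferentiableAt ℝ (H r) x := by
    intro r hr x
    rcases Nat.eq_zero_or_pos r with rfl | h
    · rw [hH0]; exact differentiableAt_const (0 : ℝ)
    · exact (hHsmooth r h hr).differentiable (by simp) x
  have hWd : ∀ r ≤ M, ∀ x, DifferentiableAt ℝ (W r) x := by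
    intro r hr x
    rcases Nat.eq_zero_or_pos r with rfl | h
    · rw [hW0]; exact differentiableAt_const (1 : ℝ)
    · exact (hWsmooth r h hr).differentiable (by simp) x
  have hWp : ∀ r ≤ M, ∀ x v, fderiv ℝ (W r) x (0, v) = 0 := by
    intro r hr x v
    have hq : ∀ q p p', W r (q, p) = W r (q, p') := by
      rcases Nat.eq_zero_or_pos r with rfl | h
      · rw [hW0]; intros; rfl
      · exact hWq r h hr
    rw [← (hWd r hr x).lineDeriv_eq_fderiv, lineDeriv]
    have : (fun t : ℝ => W r (x + t • ((0 : Fin n → ℝ), v))) = fun _ => W r x := by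
      funext t
      obtain ⟨q, p⟩ := x
      simpa using hq q (p + t • v) p
    rw [this]
    simp
  intro r' s' hr1 hr2 hs1 hs2
  obtain ⟨r, rfl⟩ : ∃ r, r' = r + 1 := ⟨r' - 1, by omega⟩
  obtain ⟨s, rfl⟩ : ∃ s, s' = s + 1 := ⟨s' - 1, by omega⟩
  have hr : r ≤ M := by omega
  have hs : s ≤ M := by omega
  funext x
  have hne := hWne x
  have i1 := congrFun (hinv r s hr hs) x
  have i2 := congrFun (hinv r m hr hm') x
  have i3 := congrFun (hinv m s hm' hs) x
  have c1 := congrFun (hcompat r s hr hs) x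
  have c2 := congrFun (hcompat r m hr hm') x
  have c3 := congrFun (hcompat s m hs hm') x
  have key : poissonBracket (Hb (r+1)) (Hb (s+1)) x =
      poissonBracket (H r) (H s) x - W s x / W m x * poissonBracket (H r) (H m) x
      - W r x / W m x * poissonBracket (H m) (H s) x
      + H m x / (W m x)^2 * (W m x * poissonBracket (H s) (W r) x
        - W r x * poissonBracket (H s) (W m) x
        - W s x / W m x * (W m x * poissonBracket (H m) (W r) x
          - W r x * poissonBracket (H m) (W m) x)
        - (W m x * poissonBracket (H r) (W s) x - W s x * poissonBracket (H r) (W m) x)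
        + W r x / W m x * (W m x * poissonBracket (H m) (W s) x
          - W s x * poissonBracket (H m) (W m) x)) := by
    rw [hHb r hr, hHb s hs]
    simp only [poissonBracket, Finset.mul_sum, ← Finset.sum_sub_distrib, ← Finset.sum_add_distrib]
    refine Finset.sum_congr rfl fun i _ => ?_
    simp only [fderiv_Hb_aux _ _ _ _ x (hHd r hr x) (hWd r hr x) (hWd m hm' x) (hHd m hm' x) hne,
      fderiv_Hb_aux _ _ _ _ x (hHd s hs x) (hWd s hs x) (hWd m hm' x) (hHd m hm' x) hne,
      hWp r hr, hWp s hs, hWp m hm']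
    ring
  rw [key, i1, i2, i3, c1, c2, c3]
  simp only [Pi.zero_apply]
  field_simp
  ring
end

section
/- Let N ≥ 1, n ≥ 2, and fix an integer n_1 with 2 ≤ n_1 ≤ n. Let A : ℝ^N → Mat_{N×N}(ℝ) be a matrix field, and let H_1, …, H_n and ρ_1, …, ρ_n be smooth real functions on ℝ^N with ρ_{n_1−1} nowhere vanishing; set H_0 := 0, H_{n+1} := 0, ρ_0 := 1, ρ_{n+1} := 0. Assume the Benenti quasi-bi-Hamiltonian chain: dH_{r+1} = dH_r·A + ρ_r dH_1 for r = 1, …, n, and dρ_{r+1} = dρ_r·A + ρ_r dρ_1 for r = 0, …, n. Define H̃_{r+1} := H_r − (ρ_r/ρ_{n_1−1})·H_{n_1−1} for r = 0, …, n+1 (so H̃_{n_1} = 0 and H̃_{n+2} = 0), α_r := ρ_r − ρ_{r−1}ρ_{n_1}/ρ_{n_1−1}, and β_r := ρ_{r−1}/ρ_{n_1−1} for r = 1, …, n+1. Then the one-hole quasi-bi-Hamiltonian chain holds: dH̃_{r+1} = dH̃_r·A + α_r dH̃_1 + β_r dH̃_{n_1+1} for r = 1, …, n+1. -/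
open ContDiff Matrix

/-- Let `A : ℝ^N → Mat_{N×N}(ℝ)` be a matrix field, and let
`H 1, …, H n` and `ρ 1, …, ρ n` be smooth functions on `ℝ^N` with `ρ (n₁ - 1)` nowhere
vanishing (`2 ≤ n₁ ≤ n`); set `H 0 = 0`, `H (n+1) = 0`, `ρ 0 = 1`, `ρ (n+1) = 0`.
Assume the Benenti quasi-bi-Hamiltonian chain `dH (r+1) = dH r · A + ρ r • dH 1`
(`r = 1, …, n`) and `dρ (r+1) = dρ r · A + ρ r • dρ 1` (`r = 0, …, n`), where
`(dF · A)(x)(v) = dF_x (A x *ᵥ v)`.  Define the one-hole deformation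
`H' (r+1) = H r - (ρ r / ρ (n₁-1)) * H (n₁-1)` (`r = 0, …, n+1`),
`α r = ρ r - ρ (r-1) * ρ n₁ / ρ (n₁-1)` and `β r = ρ (r-1) / ρ (n₁-1)`
(`r = 1, …, n+1`).  Then the one-hole quasi-bi-Hamiltonian chain holds:
`dH' (r+1) = dH' r · A + α r • dH' 1 + β r • dH' (n₁+1)` for `r = 1, …, n+1`. -/
theorem one_hole_quasi_bihamiltonian_chain
    {N n : ℕ} (hN : 1 ≤ N) (hn : 2 ≤ n) (n₁ : ℕ) (hn₁ : 2 ≤ n₁) (hn₁' : n₁ ≤ n)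
    (A : (Fin N → ℝ) → Matrix (Fin N) (Fin N) ℝ)
    (H ρ : ℕ → (Fin N → ℝ) → ℝ)
    (hHsmooth : ∀ r, 1 ≤ r → r ≤ n → ContDiff ℝ ∞ (H r))
    (hρsmooth : ∀ r, 1 ≤ r → r ≤ n → ContDiff ℝ ∞ (ρ r))
    (hρne : ∀ x, ρ (n₁ - 1) x ≠ 0)
    (hH0 : H 0 = 0) (hHtop : H (n + 1) = 0)
    (hρ0 : ρ 0 = fun _ => 1) (hρtop : ρ (n + 1) = 0)
    (hHchain : ∀ r, 1 ≤ r → r ≤ n → ∀ x v,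
      fderiv ℝ (H (r + 1)) x v
        = fderiv ℝ (H r) x (A x *ᵥ v) + ρ r x * fderiv ℝ (H 1) x v)
    (hρchain : ∀ r, r ≤ n → ∀ x v,
      fderiv ℝ (ρ (r + 1)) x v
        = fderiv ℝ (ρ r) x (A x *ᵥ v) + ρ r x * fderiv ℝ (ρ 1) x v)
    (H' α β : ℕ → (Fin N → ℝ) → ℝ)
    (hH' : ∀ r ≤ n + 1, H' (r + 1) = fun x => H r x - ρ r x / ρ (n₁ - 1) x * H (n₁ - 1) x)
    (hα : ∀ r, 1 ≤ r → r ≤ n + 1 →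
      α r = fun x => ρ r x - ρ (r - 1) x * ρ n₁ x / ρ (n₁ - 1) x)
    (hβ : ∀ r, 1 ≤ r → r ≤ n + 1 → β r = fun x => ρ (r - 1) x / ρ (n₁ - 1) x) :
    ∀ r, 1 ≤ r → r ≤ n + 1 → ∀ x v,
      fderiv ℝ (H' (r + 1)) x v
        = fderiv ℝ (H' r) x (A x *ᵥ v) + α r x * fderiv ℝ (H' 1) x v
          + β r x * fderiv ℝ (H' (n₁ + 1)) x v := by
  have dH : ∀ r, r ≤ n + 1 → Differentiable ℝ (H r) := by
    intro r hr
    rcases Nat.eq_zero_or_pos r with h | h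
    · subst h; rw [hH0]; exact differentiable_const _
    · rcases Nat.lt_or_ge n r with h2 | h2
      · obtain rfl : r = n + 1 := by omega
        rw [hHtop]; exact differentiable_const _
      · exact (hHsmooth r h h2).differentiable (by simp)
  have dρ : ∀ r, r ≤ n + 1 → Differentiable ℝ (ρ r) := by
    intro r hr
    rcases Nat.eq_zero_or_pos r with h | h
    · subst h; rw [hρ0]; exact differentiable_const _
    · rcases Nat.lt_or_ge n r with h2 | h2
      · obtain rfl : r = n + 1 := by omega
        rw [hρtop]; exact differentiable_const _
      · exact (hρsmooth r h h2).differentiable (by simp)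
  have hHc : ∀ r, r ≤ n → ∀ x v, fderiv ℝ (H (r + 1)) x v
        = fderiv ℝ (H r) x (A x *ᵥ v) + ρ r x * fderiv ℝ (H 1) x v := by
    intro r hr x v
    rcases Nat.eq_zero_or_pos r with h | h
    · subst h; simp [hH0, hρ0]
    · exact hHchain r h hr x v
  obtain ⟨m, rfl⟩ : ∃ m, n₁ = m + 1 := ⟨n₁ - 1, by omega⟩
  simp only [Nat.add_sub_cancel] at *
  have key : ∀ r, r ≤ n + 1 → ∀ x v, fderiv ℝ (H' (r + 1)) x v
      = fderiv ℝ (H r) x v - ((fderiv ℝ (ρ r) x v * ρ m x - ρ r x * fderiv ℝ (ρ m) x v)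
          / (ρ m x) ^ 2 * H m x + ρ r x / ρ m x * fderiv ℝ (H m) x v) := by
    intro r hr x v
    have h1 := (dH r hr x).hasFDerivAt
    have h2 := (dρ r hr x).hasFDerivAt
    have h3 := (dρ m (by omega) x).hasFDerivAt
    have h4 := (dH m (by omega) x).hasFDerivAt
    have h5 := h1.sub ((h2.mul ((hasDerivAt_inv (hρne x)).comp_hasFDerivAt x h3)).mul h4)
    have h6 : H' (r + 1) = H r - (ρ r * (Inv.inv ∘ ρ m)) * H m := by
      rw [hH' r hr]; funext y; simp [div_eq_mul_inv]
    rw [h6, h5.fderiv]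
    have := hρne x
    simp
    field_simp
    ring
  intro r hr1 hr2 x v
  obtain ⟨s, rfl⟩ : ∃ s, r = s + 1 := ⟨r - 1, by omega⟩
  have hs : s ≤ n := by omega
  have k0 := key 0 (by omega) x v
  rw [zero_add] at k0
  rw [key (s + 1) hr2, key s (by omega), k0, key (m + 1) (by omega), hα _ hr1 hr2, hβ _ hr1 hr2,
    hHc s hs, hρchain s hs, hHc m (by omega), hρchain m (by omega)]
  have := hρne x
  simp only [Nat.add_sub_cancel, hH0, hρ0]
  simp
  field_simp
  ring
end

section
/- (Inductive step for the k-hole quasi-bi-Hamiltonian chain.) Let N, n, k ≥ 1 and fix integers 1 < n_1 < ⋯ < n_k < n_{k+1} ≤ n+k with n_{k+1} − 1 ∉ {n_1,…,n_k}; set n_0 := 0 and m := n_{k+1} − 1. Let A : ℝ^N → Mat_{N×N}(ℝ) be a matrix field, let H̃_1, …, H̃_{n+k} be smooth real functions on ℝ^N with H̃_{n_i} = 0 for i = 1,…,k and the convention H̃_{n+k+1} := 0, and let α_r^{n_i} (i = 0,…,k; r = 0,…,n+k+1) be smooth real functions satisfying α_0^{n_0} = 1, α_0^{n_i} = 0 for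 i ≥ 1, α_{n_j}^{n_0} = 0 and α_{n_j}^{n_i} = δ_{ij} for i,j ∈ {1,…,k}, with α_m^{n_0} nowhere vanishing. Assume: dH̃_{r+1} = dH̃_r·A + Σ_{i=0}^{k} α_r^{n_i} dH̃_{n_i+1} for r = 1,…,n+k, and dα_{r+1}^{n_i} = dα_r^{n_i}·A + Σ_{j=0}^{k} α_r^{n_j} dα_{n_j+1}^{n_i} for r = 0,…,n+k and i = 0,…,k. Define H̄_1 := −H̃_m/α_m^{n_0} and H̄_{r+1} := H̃_r − (α_r^{n_0}/α_m^{n_0})·H̃_m for r = 1,…,n+k+1, and for r = 0,…,n+k define ᾱ_{r+1}^{n_i+1} := α_r^{n_i} − (α_r^{n_0}/α_m^{n_0})·α_m^{n_i} (i = 1,…,k), ᾱ_{r+1}^{n_{k+1}} := α_r^{n_0}/α_m^{n_0}, and ᾱ_{r+1}^{0} := α_{r+1}^{n_0} + (α_r^{n_0}/α_m^{n_0})·Σ_{i=1}^{k} α_m^{n_i} α_{n_i+1}^{n_0} − (α_r^{n_0}/α_m^{n_0})·α_{n_{k+1}}^{n_0} − Σ_{i=1}^{k} α_r^{n_i} α_{n_i+1}^{n_0}.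 Then for r = 1,…,n+k: dH̄_{r+1} = dH̄_r·A + ᾱ_r^{0} dH̄_1 + Σ_{i=1}^{k} ᾱ_r^{n_i+1} dH̄_{n_i+2} + ᾱ_r^{n_{k+1}} dH̄_{n_{k+1}+1}. -/
open ContDiff Matrix

theorem aux_fderiv {N : ℕ} (f g a p : (Fin N → ℝ) → ℝ) (x v : Fin N → ℝ)
    (hf : DifferentiableAt ℝ f x) (hg : DifferentiableAt ℝ g x)
    (ha : DifferentiableAt ℝ a x) (hp : DifferentiableAt ℝ p x) (hne : a x ≠ 0) :
    fderiv ℝ (fun y => f y - g y / a y * p y) x v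
      = fderiv ℝ f x v - g x / a x * fderiv ℝ p x v
        - p x * (fderiv ℝ g x v / a x - g x * fderiv ℝ a x v / (a x) ^ 2) := by
  have hinv : HasFDerivAt (fun y => (a y)⁻¹) (-((a x) ^ 2)⁻¹ • fderiv ℝ a x) x := by
    have := (hasDerivAt_inv hne).comp_hasFDerivAt x ha.hasFDerivAt
    exact this
  have h := (hf.hasFDerivAt.sub ((hg.hasFDerivAt.mul hinv).mul hp.hasFDerivAt))
  have e : (fun y => f y - g y / a y * p y) = f - (g * fun y => (a y)⁻¹) * p := by
    funext y; simp [div_eq_mul_inv]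
  rw [e, h.fderiv]
  simp
  field_simp
  ring

/-- (Inductive step for the `k`-hole quasi-bi-Hamiltonian chain.)
Let `1 < ns 1 < ⋯ < ns k < ns (k+1) ≤ n+k` with `ns (k+1) - 1` not among
`ns 1, …, ns k`; set `ns 0 = 0` and `m = ns (k+1) - 1`.  Let `Ht 1, …, Ht (n+k)` be
the `k`-hole deformed Hamiltonians (`Ht (ns i) = 0` for `i = 1..k`, `Ht (n+k+1) = 0`)
and `α i r` (`= α_r^{n_i}`) the deformed basic separable potentials, satisfying the
normalizations and the `k`-hole quasi-bi-Hamiltonian chain together with the chain for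
the `α`'s.  Define the `(k+1)`-hole Hamiltonians `Hb` and coefficients `b0, bi, blast`
as in the text.  Then the `(k+1)`-hole quasi-bi-Hamiltonian chain holds for
`r = 1, …, n+k`. -/
theorem k_hole_quasi_bihamiltonian_chain_inductive_step
    {N n k : ℕ} (hN : 1 ≤ N) (hn : 1 ≤ n) (hk : 1 ≤ k)
    (ns : ℕ → ℕ) (hns0 : ns 0 = 0) (hns1 : 1 < ns 1)
    (hnsmono : ∀ i, 1 ≤ i → i ≤ k → ns i < ns (i + 1)) (hnstop : ns (k + 1) ≤ n + k)
    (hnotahole : ∀ i, 1 ≤ i → i ≤ k → ns (k + 1) - 1 ≠ ns i)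
    (m : ℕ) (hm : m = ns (k + 1) - 1)
    (A : (Fin N → ℝ) → Matrix (Fin N) (Fin N) ℝ)
    (Ht : ℕ → (Fin N → ℝ) → ℝ)
    (hHtsmooth : ∀ r, 1 ≤ r → r ≤ n + k → ContDiff ℝ ∞ (Ht r))
    (hHthole : ∀ i, 1 ≤ i → i ≤ k → Ht (ns i) = 0)
    (hHttop : Ht (n + k + 1) = 0)
    (α : ℕ → ℕ → (Fin N → ℝ) → ℝ)
    (hαsmooth : ∀ i ≤ k, ∀ r ≤ n + k + 1, ContDiff ℝ ∞ (α i r))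
    (hα00 : α 0 0 = fun _ => 1)
    (hαi0 : ∀ i, 1 ≤ i → i ≤ k → α i 0 = 0)
    (hα0hole : ∀ j, 1 ≤ j → j ≤ k → α 0 (ns j) = 0)
    (hαihole : ∀ i j, 1 ≤ i → i ≤ k → 1 ≤ j → j ≤ k →
      α i (ns j) = fun _ => if i = j then 1 else 0)
    (hαmne : ∀ x, α 0 m x ≠ 0)
    (hHtchain : ∀ r, 1 ≤ r → r ≤ n + k → ∀ x v,
      fderiv ℝ (Ht (r + 1)) x v
        = fderiv ℝ (Ht r) x (A x *ᵥ v)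
          + ∑ i ∈ Finset.range (k + 1), α i r x * fderiv ℝ (Ht (ns i + 1)) x v)
    (hαchain : ∀ i ≤ k, ∀ r ≤ n + k, ∀ x v,
      fderiv ℝ (α i (r + 1)) x v
        = fderiv ℝ (α i r) x (A x *ᵥ v)
          + ∑ j ∈ Finset.range (k + 1), α j r x * fderiv ℝ (α i (ns j + 1)) x v)
    (Hb : ℕ → (Fin N → ℝ) → ℝ)
    (hHb1 : Hb 1 = fun x => -(Ht m x / α 0 m x))
    (hHb : ∀ r, 1 ≤ r → r ≤ n + k + 1 →
      Hb (r + 1) = fun x => Ht r x - α 0 r x / α 0 m x * Ht m x)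
    (b0 blast : ℕ → (Fin N → ℝ) → ℝ) (bi : ℕ → ℕ → (Fin N → ℝ) → ℝ)
    (hbi : ∀ i, 1 ≤ i → i ≤ k → ∀ r ≤ n + k,
      bi i (r + 1) = fun x => α i r x - α 0 r x / α 0 m x * α i m x)
    (hblast : ∀ r ≤ n + k, blast (r + 1) = fun x => α 0 r x / α 0 m x)
    (hb0 : ∀ r ≤ n + k,
      b0 (r + 1) = fun x =>
        α 0 (r + 1) x
          + α 0 r x / α 0 m x * ∑ i ∈ Finset.Icc 1 k, α i m x * α 0 (ns i + 1) x
          - α 0 r x / α 0 m x * α 0 (ns (k + 1)) x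
          - ∑ i ∈ Finset.Icc 1 k, α i r x * α 0 (ns i + 1) x) :
    ∀ r, 1 ≤ r → r ≤ n + k → ∀ x v,
      fderiv ℝ (Hb (r + 1)) x v
        = fderiv ℝ (Hb r) x (A x *ᵥ v) + b0 r x * fderiv ℝ (Hb 1) x v
          + ∑ i ∈ Finset.Icc 1 k, bi i r x * fderiv ℝ (Hb (ns i + 2)) x v
          + blast r x * fderiv ℝ (Hb (ns (k + 1) + 1)) x v := by
  have hmono : ∀ d i, 1 ≤ i → i + d = k → ns i < ns (k + 1) := by
    intro d
    induction d with
    | zero => intro i h1 h2; obtain rfl : i = k := by omega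
              exact hnsmono _ h1 le_rfl
    | succ d ih =>
      intro i h1 h2
      exact (hnsmono i h1 (by omega)).trans (ih (i + 1) (by omega) (by omega))
  have hlt : ∀ i, 1 ≤ i → i ≤ k → ns i < ns (k + 1) := fun i h1 h2 =>
    hmono (k - i) i h1 (by omega)
  have h1k := hlt 1 le_rfl hk
  have hm1 : ns (k + 1) = m + 1 := by omega
  have hmpos : 1 ≤ m := by omega
  have dH : ∀ r, 1 ≤ r → r ≤ n + k → ∀ x, DifferentiableAt ℝ (Ht r) x := fun r h1 h2 x =>
    ((hHtsmooth r h1 h2).differentiable (by simp)) x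
  have dα : ∀ r, r ≤ n + k → ∀ x, DifferentiableAt ℝ (α 0 r) x := fun r h2 x =>
    ((hαsmooth 0 (by omega) r (by omega)).differentiable (by simp)) x
  have key : ∀ r, 1 ≤ r → r ≤ n + k → ∀ x v, fderiv ℝ (Hb (r + 1)) x v
      = fderiv ℝ (Ht r) x v - α 0 r x / α 0 m x * fderiv ℝ (Ht m) x v
        - Ht m x * (fderiv ℝ (α 0 r) x v / α 0 m x
          - α 0 r x * fderiv ℝ (α 0 m) x v / (α 0 m x) ^ 2) := by
    intro r h1 h2 x v
    rw [hHb r h1 (by omega)]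
    exact aux_fderiv _ _ _ _ x v (dH r h1 h2 x) (dα r h2 x) (dα m (by omega) x)
      (dH m hmpos (by omega) x) (hαmne x)
  have key1 : ∀ x v, fderiv ℝ (Hb 1) x v
      = 0 - α 0 0 x / α 0 m x * fderiv ℝ (Ht m) x v
        - Ht m x * (fderiv ℝ (α 0 0) x v / α 0 m x
          - α 0 0 x * fderiv ℝ (α 0 m) x v / (α 0 m x) ^ 2) := by
    intro x v
    have e : Hb 1 = fun y => (fun _ => (0 : ℝ)) y - α 0 0 y / α 0 m y * Ht m y := by
      rw [hHb1, hα00]; funext y; ring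
    rw [e, aux_fderiv _ _ _ _ x v (differentiableAt_const _) (dα 0 (by omega) x)
      (dα m (by omega) x) (dH m hmpos (by omega) x) (hαmne x)]
    simp
  have hsplit : ∀ f : ℕ → ℝ, ∑ i ∈ Finset.range (k + 1), f i
      = f 0 + ∑ i ∈ Finset.Icc 1 k, f i := by
    intro f
    rw [Finset.range_eq_Ico, Finset.sum_eq_sum_Ico_succ_bot (by omega)]
    rfl
  intro r hr1 hr2 x v
  obtain ⟨s, rfl⟩ : ∃ s, r = s + 1 := ⟨r - 1, by omega⟩
  have hA : ∃ G : ℝ, fderiv ℝ (Hb (s + 1)) x (A x *ᵥ v)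
      = G - α 0 s x / α 0 m x * fderiv ℝ (Ht m) x (A x *ᵥ v)
        - Ht m x * (fderiv ℝ (α 0 s) x (A x *ᵥ v) / α 0 m x
          - α 0 s x * fderiv ℝ (α 0 m) x (A x *ᵥ v) / (α 0 m x) ^ 2) ∧
      fderiv ℝ (Ht (s + 1)) x v
        = G + ∑ i ∈ Finset.range (k + 1), α i s x * fderiv ℝ (Ht (ns i + 1)) x v := by
    rcases Nat.eq_zero_or_pos s with rfl | hs
    · refine ⟨0, key1 x _, ?_⟩
      rw [hsplit, Finset.sum_eq_zero]
      · simp [hα00, hns0]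
      · intro i hi
        rw [Finset.mem_Icc] at hi
        simp [hαi0 i hi.1 hi.2]
    · exact ⟨_, key s hs (by omega) x _, hHtchain s hs (by omega) x v⟩
  obtain ⟨G, hG1, hG2⟩ := hA
  have hP := hHtchain m hmpos (by omega) x v
  have hQ := hαchain 0 (by omega) m (by omega) x v
  have hR := hαchain 0 (by omega) s (by omega) x v
  have hsum : ∑ i ∈ Finset.Icc 1 k, bi i (s + 1) x * fderiv ℝ (Hb (ns i + 2)) x v
      = (∑ i ∈ Finset.Icc 1 k, α i s x * fderiv ℝ (Ht (ns i + 1)) x v)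
        - α 0 s x / α 0 m x * (∑ i ∈ Finset.Icc 1 k, α i m x * fderiv ℝ (Ht (ns i + 1)) x v)
        - Ht m x / α 0 m x * (∑ i ∈ Finset.Icc 1 k, α i s x * fderiv ℝ (α 0 (ns i + 1)) x v)
        + Ht m x / α 0 m x * (α 0 s x / α 0 m x) *
          (∑ i ∈ Finset.Icc 1 k, α i m x * fderiv ℝ (α 0 (ns i + 1)) x v)
        + (Ht m x * fderiv ℝ (α 0 m) x v / (α 0 m x) ^ 2 - fderiv ℝ (Ht m) x v / α 0 m x) *
          (∑ i ∈ Finset.Icc 1 k, α i s x * α 0 (ns i + 1) x)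
        - (Ht m x * fderiv ℝ (α 0 m) x v / (α 0 m x) ^ 2 - fderiv ℝ (Ht m) x v / α 0 m x) *
          (α 0 s x / α 0 m x) * (∑ i ∈ Finset.Icc 1 k, α i m x * α 0 (ns i + 1) x) := by
    simp only [Finset.mul_sum, ← Finset.sum_sub_distrib, ← Finset.sum_add_distrib]
    refine Finset.sum_congr rfl fun i hi => ?_
    rw [Finset.mem_Icc] at hi
    have := hlt i hi.1 hi.2
    rw [hbi i hi.1 hi.2 s (by omega), key (ns i + 1) (by omega) (by omega) x v]
    ring
  rw [hsum, key (s + 1) hr1 hr2, hG1, key1, hb0 s (by omega), hblast s (by omega), hm1,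
    key (m + 1) (by omega) (by omega)]
  rw [hsplit] at hP hQ hR hG2
  simp only [hns0, zero_add] at hP hQ hR hG2
  have c0 : fderiv ℝ (α 0 0) x v = 0 := by rw [hα00]; simp
  have c1 : α 0 0 x = 1 := by rw [hα00]
  rw [c0, c1]
  have hne := hαmne x
  rw [hP, hQ, hR, hG2]
  field_simp
  ring
end

section
/- Let R be a commutative ring, p ∈ R[X] monic of degree n, and fix an integer n_1 with 1 < n_1 < n+1. Let a, b, c ∈ R^{n+1} satisfy a_{n_1} = 0, b_{n_1} = 0, c_{n_1} = 1, and suppose p divides each of the polynomials X^m + Σ_{r=1}^{n+1} a_r X^{(n+1)−r}, X^{n+1} + Σ_{r=1}^{n+1} b_r X^{(n+1)−r}, and Σ_{r=1}^{n+1} c_r X^{(n+1)−r} in R[X] (for some m ≥ 0). Define d_r := a_{r+1} − b_r a_1 − c_r a_{n_1+1} for r = 1,…,n+1, with the convention a_{n+2} := 0. Then d_{n_1} = 0 and p divides X^{m+1} + Σ_{r=1}^{n+1} d_r X^{(n+1)−r}. (With a = Ṽ^{(m)}, b = Ṽ^{(n+1)}, c = Ṽ^{(n+1−n_1)}, this is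 the recursion Ṽ_r^{(m+1)} = Ṽ_{r+1}^{(m)} − Ṽ_r^{(n+1)} Ṽ_1^{(m)} − Ṽ_r^{(n+1−n_1)} Ṽ_{n_1+1}^{(m)} for the one-hole deformed basic separable potentials.) -/
open Polynomial

/-- Let `R` be a commutative ring, `p ∈ R[X]` monic of degree `n`,
and `1 < n₁ < n+1`.  Let `a, b, c` (indexed by `1, …, n+1`) satisfy `a n₁ = 0`,
`b n₁ = 0`, `c n₁ = 1`, with `p` dividing `X^m + ∑_r a r * X^(n+1-r)`,
`X^(n+1) + ∑_r b r * X^(n+1-r)` and `∑_r c r * X^(n+1-r)`.  Define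
`d r = a (r+1) - b r * a 1 - c r * a (n₁+1)` (with `a (n+2) = 0`).  Then `d n₁ = 0`
and `p` divides `X^(m+1) + ∑_r d r * X^(n+1-r)`.  (This is the recursion for the
one-hole deformed basic separable potentials.) -/
theorem one_hole_deformed_potentials_recursion
    {R : Type*} [CommRing R] {n : ℕ} (p : R[X]) (hmonic : p.Monic)
    (hdeg : p.natDegree = n) (n₁ : ℕ) (hn₁ : 1 < n₁) (hn₁' : n₁ < n + 1)
    (m : ℕ) (a b c : ℕ → R)
    (ha : a n₁ = 0) (hb : b n₁ = 0) (hc : c n₁ = 1) (hatop : a (n + 2) = 0)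
    (hdiva : p ∣ X ^ m + ∑ r ∈ Finset.Icc 1 (n + 1), Polynomial.C (a r) * X ^ (n + 1 - r))
    (hdivb : p ∣ X ^ (n + 1) + ∑ r ∈ Finset.Icc 1 (n + 1), Polynomial.C (b r) * X ^ (n + 1 - r))
    (hdivc : p ∣ ∑ r ∈ Finset.Icc 1 (n + 1), Polynomial.C (c r) * X ^ (n + 1 - r))
    (d : ℕ → R) (hd : ∀ r, 1 ≤ r → r ≤ n + 1 → d r = a (r + 1) - b r * a 1 - c r * a (n₁ + 1)) :
    d n₁ = 0 ∧
      p ∣ X ^ (m + 1) + ∑ r ∈ Finset.Icc 1 (n + 1), Polynomial.C (d r) * X ^ (n + 1 - r) := by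
  have hI : ∀ f : ℕ → R[X], ∑ r ∈ Finset.Icc 1 (n + 1), f r
      = ∑ i ∈ Finset.range (n + 1), f (i + 1) := by
    intro f
    rw [Finset.range_eq_Ico, Finset.sum_Ico_add' f 0 (n + 1) 1]
    rfl
  have key : X * ∑ r ∈ Finset.Icc 1 (n + 1), Polynomial.C (a r) * X ^ (n + 1 - r)
      = Polynomial.C (a 1) * X ^ (n + 1)
        + ∑ r ∈ Finset.Icc 1 (n + 1), Polynomial.C (a (r + 1)) * X ^ (n + 1 - r) := by
    rw [hI, hI, Finset.sum_range_succ', Finset.sum_range_succ _ n, hatop, mul_add, Finset.mul_sum]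
    have h : ∀ i ∈ Finset.range n,
        X * (Polynomial.C (a (i + 1 + 1)) * X ^ (n + 1 - (i + 1 + 1)))
          = Polynomial.C (a (i + 1 + 1)) * X ^ (n + 1 - (i + 1)) := by
      intro i hi
      have hi' := Finset.mem_range.mp hi
      have e : n + 1 - (i + 1) = (n + 1 - (i + 1 + 1)) + 1 := by omega
      rw [e, pow_succ]
      ring
    rw [Finset.sum_congr rfl h]
    simp only [zero_add, Nat.add_sub_cancel, Polynomial.C_0, zero_mul, add_zero]
    ring
  refine ⟨?_, ?_⟩
  · rw [hd n₁ (by omega) (by omega), hb, hc]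
    ring
  · have hD : ∑ r ∈ Finset.Icc 1 (n + 1), Polynomial.C (d r) * X ^ (n + 1 - r)
        = ∑ r ∈ Finset.Icc 1 (n + 1), Polynomial.C (a (r + 1)) * X ^ (n + 1 - r)
          - Polynomial.C (a 1) * ∑ r ∈ Finset.Icc 1 (n + 1), Polynomial.C (b r) * X ^ (n + 1 - r)
          - Polynomial.C (a (n₁ + 1)) *
            ∑ r ∈ Finset.Icc 1 (n + 1), Polynomial.C (c r) * X ^ (n + 1 - r) := by
      rw [Finset.mul_sum, Finset.mul_sum, ← Finset.sum_sub_distrib, ← Finset.sum_sub_distrib]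
      refine Finset.sum_congr rfl fun r hr => ?_
      have hr' := Finset.mem_Icc.mp hr
      rw [hd r hr'.1 hr'.2]
      simp only [Polynomial.C_sub, Polynomial.C_mul]
      ring
    have h := dvd_sub (dvd_sub (hdiva.mul_left X) (hdivb.mul_left (Polynomial.C (a 1))))
      (hdivc.mul_left (Polynomial.C (a (n₁ + 1))))
    convert h using 1
    rw [hD, mul_add, key]
    ring
end

section
/- Let R be a commutative ring, p ∈ R[X] monic of degree n, k ≥ 1, and fix integers 1 < n_1 < ⋯ < n_k < n+k. Let a, b, c^{(1)}, …, c^{(k)} ∈ R^{n+k} satisfy a_{n_j} = 0, b_{n_j} = 0, and c^{(i)}_{n_j} = δ_{ij} for all i, j ∈ {1,…,k}, and suppose p divides each of the polynomials X^m + Σ_{r=1}^{n+k} a_r X^{(n+k)−r}, X^{n+k} + Σ_{r=1}^{n+k} b_r X^{(n+k)−r}, and Σ_{r=1}^{n+k} c^{(i)}_r X^{(n+k)−r} (i = 1,…,k) in R[X] (for some m ≥ 0). Define d_r := a_{r+1} − b_r a_1 − Σ_{i=1}^{k} c^{(i)}_r a_{n_i+1} for r = 1,…,n+k, with the convention a_{n+k+1}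 := 0. Then d_{n_j} = 0 for all j = 1,…,k, and p divides X^{m+1} + Σ_{r=1}^{n+k} d_r X^{(n+k)−r}. (This is the recursion Ṽ_r^{(m+1)} = Ṽ_{r+1}^{(m)} − Ṽ_r^{(n+k)} Ṽ_1^{(m)} − Σ_{i=1}^{k} Ṽ_r^{(n+k−n_i)} Ṽ_{n_i+1}^{(m)} for the k-hole deformed basic separable potentials.) -/
open Polynomial

theorem shift_aux {R : Type*} [CommRing R] (N : ℕ) (a : ℕ → R) (h : a (N + 1) = 0) :
    (X : R[X]) * ∑ r ∈ Finset.Icc 1 N, Polynomial.C (a r) * X ^ (N - r) =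
      Polynomial.C (a 1) * X ^ N + ∑ r ∈ Finset.Icc 1 N, Polynomial.C (a (r + 1)) * X ^ (N - r) := by
  have e : ∀ f : ℕ → R[X], ∑ r ∈ Finset.Icc 1 N, f r = ∑ i ∈ Finset.range N, f (i + 1) := by
    intro f
    rw [Finset.range_eq_Ico, Finset.sum_Ico_add' f 0 N 1]
    rfl
  rw [e, e, Finset.mul_sum]
  have h1 : ∑ i ∈ Finset.range N, (X : R[X]) * (Polynomial.C (a (i + 1)) * X ^ (N - (i + 1))) =
      ∑ i ∈ Finset.range (N + 1), Polynomial.C (a (i + 1)) * X ^ (N - i) := by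
    rw [Finset.sum_range_succ, h, map_zero, zero_mul, add_zero]
    refine Finset.sum_congr rfl fun i hi => ?_
    have hi' := Finset.mem_range.mp hi
    have : N - i = (N - (i + 1)) + 1 := by omega
    rw [this, pow_succ]
    ring
  rw [h1, Finset.sum_range_succ', add_comm]
  simp

/-- Let `R` be a commutative ring, `p ∈ R[X]` monic of degree `n`,
`k ≥ 1`, and `1 < ns 1 < ⋯ < ns k < n+k`.  Let `a, b, c 1, …, c k` (indexed by
`1, …, n+k`) satisfy `a (ns j) = 0`, `b (ns j) = 0`, `c i (ns j) = δ_{ij}`, with `p`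
dividing `X^m + ∑_r a r * X^(n+k-r)`, `X^(n+k) + ∑_r b r * X^(n+k-r)` and
`∑_r c i r * X^(n+k-r)` for each `i = 1, …, k`.  Define
`d r = a (r+1) - b r * a 1 - ∑_{i=1}^{k} c i r * a (ns i + 1)` (with `a (n+k+1) = 0`).
Then `d (ns j) = 0` for all `j = 1, …, k`, and `p` divides
`X^(m+1) + ∑_r d r * X^(n+k-r)`.  (This is the recursion for the `k`-hole deformed
basic separable potentials.) -/
theorem k_hole_deformed_potentials_recursion
    {R : Type*} [CommRing R] {n k : ℕ} (hk : 1 ≤ k)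
    (p : R[X]) (hmonic : p.Monic) (hdeg : p.natDegree = n)
    (ns : ℕ → ℕ) (hns1 : 1 < ns 1)
    (hnsmono : ∀ i, 1 ≤ i → i < k → ns i < ns (i + 1)) (hnstop : ns k < n + k)
    (m : ℕ) (a b : ℕ → R) (c : ℕ → ℕ → R)
    (ha : ∀ j, 1 ≤ j → j ≤ k → a (ns j) = 0)
    (hb : ∀ j, 1 ≤ j → j ≤ k → b (ns j) = 0)
    (hc : ∀ i j, 1 ≤ i → i ≤ k → 1 ≤ j → j ≤ k → c i (ns j) = if i = j then 1 else 0)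
    (hatop : a (n + k + 1) = 0)
    (hdiva : p ∣ X ^ m + ∑ r ∈ Finset.Icc 1 (n + k), Polynomial.C (a r) * X ^ (n + k - r))
    (hdivb : p ∣ X ^ (n + k) + ∑ r ∈ Finset.Icc 1 (n + k), Polynomial.C (b r) * X ^ (n + k - r))
    (hdivc : ∀ i, 1 ≤ i → i ≤ k →
      p ∣ ∑ r ∈ Finset.Icc 1 (n + k), Polynomial.C (c i r) * X ^ (n + k - r))
    (d : ℕ → R)
    (hd : ∀ r, 1 ≤ r → r ≤ n + k →
      d r = a (r + 1) - b r * a 1 - ∑ i ∈ Finset.Icc 1 k, c i r * a (ns i + 1)) :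
    (∀ j, 1 ≤ j → j ≤ k → d (ns j) = 0) ∧
      p ∣ X ^ (m + 1) + ∑ r ∈ Finset.Icc 1 (n + k), Polynomial.C (d r) * X ^ (n + k - r) := by
  have hlow : ∀ j, 1 ≤ j → j ≤ k → 1 ≤ ns j := by
    intro j hj
    induction j, hj using Nat.le_induction with
    | base => intro _; omega
    | succ j hj ih =>
      intro h
      have := hnsmono j hj (by omega)
      omega
  have hup : ∀ t j, j + t = k → 1 ≤ j → ns j ≤ n + k := by
    intro t
    induction t with
    | zero =>
      intro j h _
      obtain rfl : j = k := by omega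
      omega
    | succ t ih =>
      intro j h h1
      have := hnsmono j h1 (by omega)
      have := ih (j + 1) (by omega) (by omega)
      omega
  constructor
  · intro j h1 h2
    rw [hd _ (hlow j h1 h2) (hup (k - j) j (by omega) h1), hb j h1 h2]
    have : ∑ i ∈ Finset.Icc 1 k, c i (ns j) * a (ns i + 1) = a (ns j + 1) := by
      rw [Finset.sum_eq_single_of_mem j (Finset.mem_Icc.mpr ⟨h1, h2⟩)]
      · rw [hc j j h1 h2 h1 h2]; simp
      · intro i hi hij
        obtain ⟨h3, h4⟩ := Finset.mem_Icc.mp hi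
        rw [hc i j h3 h4 h1 h2, if_neg hij, zero_mul]
    rw [this]; ring
  · have hsum : ∑ r ∈ Finset.Icc 1 (n + k), Polynomial.C (d r) * X ^ (n + k - r) =
        ∑ r ∈ Finset.Icc 1 (n + k), Polynomial.C (a (r + 1)) * X ^ (n + k - r)
        - Polynomial.C (a 1) * ∑ r ∈ Finset.Icc 1 (n + k), Polynomial.C (b r) * X ^ (n + k - r)
        - ∑ i ∈ Finset.Icc 1 k, Polynomial.C (a (ns i + 1)) *
          ∑ r ∈ Finset.Icc 1 (n + k), Polynomial.C (c i r) * X ^ (n + k - r) := by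
      simp_rw [Finset.mul_sum]
      rw [Finset.sum_comm (s := Finset.Icc 1 k), ← Finset.sum_sub_distrib,
        ← Finset.sum_sub_distrib]
      refine Finset.sum_congr rfl fun r hr => ?_
      obtain ⟨h3, h4⟩ := Finset.mem_Icc.mp hr
      rw [hd r h3 h4]
      simp only [map_sub, map_mul, map_sum, sub_mul, Finset.sum_mul]
      congr 1
      · ring
      · exact Finset.sum_congr rfl fun i _ => by ring
    have hA := shift_aux (n + k) a hatop
    have h3 := Finset.dvd_sum (s := Finset.Icc 1 k) (a := p) (f := fun i =>
      Polynomial.C (a (ns i + 1)) *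
          ∑ r ∈ Finset.Icc 1 (n + k), Polynomial.C (c i r) * X ^ (n + k - r)) (by
      intro i hi
      obtain ⟨h3, h4⟩ := Finset.mem_Icc.mp hi
      exact (hdivc i h3 h4).mul_left _)
    have key := ((hdiva.mul_left X).sub (hdivb.mul_left (Polynomial.C (a 1)))).sub h3
    rw [mul_add, hA] at key
    rw [hsum]
    convert key using 1
    ring
end

section
/- Let R be a commutative ring, p ∈ R[X] monic of degree n, k ≥ 1, and m ≥ 0. Suppose w^{(1)}, …, w^{(k)} ∈ R^n satisfy: p divides X^{n+k−i} + Σ_{r=1}^{n} w^{(i)}_r X^{n−r} for each i = 1,…,k. Let V ∈ R^n with p dividing X^m + Σ_{r=1}^{n} V_r X^{n−r}, and let Ṽ ∈ R^{n+k} be related to V by the deformation relation V_r = Ṽ_{r+k} − Σ_{i=1}^{k} w^{(i)}_r Ṽ_i for r = 1,…,n. Then p divides X^m + Σ_{r=1}^{n+k} Ṽ_r X^{(n+k)−r} in R[X]. (This shows that the k-hole deformation H_r = H̃_{r+k} − Σ_i V_r^{(n+k−i)} H̃_i transforms the Benenti separation conditions of degree n−1 into the deformed separation conditions of degree n+k−1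 with the same right-hand side.) -/
open Polynomial

theorem sum_Icc_split_aux {M : Type*} [AddCommMonoid M] (n k : ℕ) (f : ℕ → M) :
    ∑ r ∈ Finset.Icc 1 (n + k), f r
      = ∑ r ∈ Finset.Icc 1 k, f r + ∑ r ∈ Finset.Icc 1 n, f (r + k) := by
  induction n with
  | zero => simp
  | succ n ih =>
    rw [show n + 1 + k = n + k + 1 by omega, Finset.sum_Icc_succ_top (by omega), ih,
      Finset.sum_Icc_succ_top (by omega), add_assoc, show n + 1 + k = n + k + 1 by omega]

/-- Let `R` be a commutative ring, `p ∈ R[X]` monic of degree `n`,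
`k ≥ 1`, `m ≥ 0`.  Suppose `w 1, …, w k` (each indexed by `1, …, n`) satisfy
`p ∣ X^(n+k-i) + ∑_{r=1}^{n} w i r * X^(n-r)` for `i = 1, …, k`.  Let `V` satisfy
`p ∣ X^m + ∑_{r=1}^{n} V r * X^(n-r)`, and let `Vt` (indexed by `1, …, n+k`) be
related to `V` by the deformation relation
`V r = Vt (r+k) - ∑_{i=1}^{k} w i r * Vt i` for `r = 1, …, n`.  Then
`p ∣ X^m + ∑_{r=1}^{n+k} Vt r * X^(n+k-r)`.  (The `k`-hole deformation transforms the
Benenti separation conditions of degree `n-1` into deformed separation conditions of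
degree `n+k-1` with the same right-hand side.) -/
theorem k_hole_deformation_preserves_separation_conditions
    {R : Type*} [CommRing R] {n k : ℕ} (hk : 1 ≤ k) (m : ℕ)
    (p : R[X]) (hmonic : p.Monic) (hdeg : p.natDegree = n)
    (w : ℕ → ℕ → R)
    (hw : ∀ i, 1 ≤ i → i ≤ k →
      p ∣ X ^ (n + k - i) + ∑ r ∈ Finset.Icc 1 n, Polynomial.C (w i r) * X ^ (n - r))
    (V Vt : ℕ → R)
    (hV : p ∣ X ^ m + ∑ r ∈ Finset.Icc 1 n, Polynomial.C (V r) * X ^ (n - r))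
    (hdef : ∀ r, 1 ≤ r → r ≤ n →
      V r = Vt (r + k) - ∑ i ∈ Finset.Icc 1 k, w i r * Vt i) :
    p ∣ X ^ m + ∑ r ∈ Finset.Icc 1 (n + k), Polynomial.C (Vt r) * X ^ (n + k - r) := by
  have h2 : p ∣ ∑ i ∈ Finset.Icc 1 k, Polynomial.C (Vt i) *
      (X ^ (n + k - i) + ∑ r ∈ Finset.Icc 1 n, Polynomial.C (w i r) * X ^ (n - r)) := by
    apply Finset.dvd_sum
    intro i hi
    rw [Finset.mem_Icc] at hi
    exact Dvd.dvd.mul_left (hw i hi.1 hi.2) _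
  have h3 := dvd_add hV h2
  convert h3 using 1
  rw [sum_Icc_split_aux, add_assoc]
  congr 1
  have h4 : ∑ r ∈ Finset.Icc 1 n, Polynomial.C (V r) * X ^ (n - r)
      = ∑ r ∈ Finset.Icc 1 n, Polynomial.C (Vt (r + k)) * X ^ (n + k - (r + k))
        - ∑ r ∈ Finset.Icc 1 n, ∑ i ∈ Finset.Icc 1 k,
          Polynomial.C (Vt i) * (Polynomial.C (w i r) * X ^ (n - r)) := by
    rw [← Finset.sum_sub_distrib]
    apply Finset.sum_congr rfl
    intro r hr
    rw [Finset.mem_Icc] at hr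
    rw [hdef r hr.1 hr.2, Nat.add_sub_add_right, map_sub, map_sum, sub_mul, Finset.sum_mul]
    congr 1
    apply Finset.sum_congr rfl
    intro i _
    rw [map_mul]
    ring
  rw [h4, Finset.sum_comm]
  simp only [mul_add, Finset.sum_add_distrib, Finset.mul_sum]
  ring
end

section
/- Let m, k ≥ 1 and work on ℝ^{m+k} with coordinates (x, c) ∈ ℝ^m × ℝ^k. Let π_0 be a differentiable antisymmetric matrix field whose entries π_0^{ab} vanish whenever a > m or b > m, which is independent of the c-variables, and which satisfies the coordinate Jacobi identity J(π_0) = 0. Let π_{1D} be a differentiable antisymmetric matrix field compatible with π_0, i.e. [π_0, π_{1D}] = 0 in the coordinate Schouten bracket. Let f_1, …, f_k be twice differentiable functions on ℝ^{m+k}, let X_i be the Hamiltonian vector fields X_i := π_0·∇f_i, let Z_i be the constant coordinate vector fields ∂/∂c_i, and define π_1 := π_{1D} + Σ_{i=1}^{k} (X_i ⊗ Z_i − Z_i ⊗ X_i) (the bivector π_{1D} + Σ_i X_i ∧ Z_i). Then π_0 and π_1 are compatible: [π_0, π_1] = 0. -/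
/-- The `a`-th coordinate unit vector of `ℝ^m × ℝ^k`, with coordinates indexed by
`Fin m ⊕ Fin k`. -/
def coordVec (m k : ℕ) : (Fin m ⊕ Fin k) → ((Fin m → ℝ) × (Fin k → ℝ))
  | Sum.inl i => (Pi.single i 1, 0)
  | Sum.inr j => ((0 : Fin m → ℝ), Pi.single j 1)

/-- The coordinate Schouten bracket
`[A,B]^{abc} = ∑_l (A^{al}∂_l B^{bc} + B^{al}∂_l A^{bc} + A^{bl}∂_l B^{ca}
 + B^{bl}∂_l A^{ca} + A^{cl}∂_l B^{ab} + B^{cl}∂_l A^{ab})`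
of two matrix fields on `ℝ^m × ℝ^k`; `A` and `B` are compatible iff it vanishes. -/
noncomputable def schoutenBracket {m k : ℕ}
    (A B : ((Fin m → ℝ) × (Fin k → ℝ)) → (Fin m ⊕ Fin k) → (Fin m ⊕ Fin k) → ℝ)
    (x : (Fin m → ℝ) × (Fin k → ℝ)) (a b c : Fin m ⊕ Fin k) : ℝ :=
  ∑ l : Fin m ⊕ Fin k,
    (A x a l * fderiv ℝ (fun y => B y b c) x (coordVec m k l)
      + B x a l * fderiv ℝ (fun y => A y b c) x (coordVec m k l)
      + A x b l * fderiv ℝ (fun y => B y c a) x (coordVec m k l)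
      + B x b l * fderiv ℝ (fun y => A y c a) x (coordVec m k l)
      + A x c l * fderiv ℝ (fun y => B y a b) x (coordVec m k l)
      + B x c l * fderiv ℝ (fun y => A y a b) x (coordVec m k l))

/-- The coordinate Jacobi expression
`J(π)^{abc} = ∑_l (π^{al} ∂_l π^{bc} + π^{bl} ∂_l π^{ca} + π^{cl} ∂_l π^{ab})`. -/
noncomputable def jacobiExpr {m k : ℕ}
    (π : ((Fin m → ℝ) × (Fin k → ℝ)) → (Fin m ⊕ Fin k) → (Fin m ⊕ Fin k) → ℝ)
    (x : (Fin m → ℝ) × (Fin k → ℝ)) (a b c : Fin m ⊕ Fin k) : ℝ :=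
  ∑ l : Fin m ⊕ Fin k,
    (π x a l * fderiv ℝ (fun y => π y b c) x (coordVec m k l)
      + π x b l * fderiv ℝ (fun y => π y c a) x (coordVec m k l)
      + π x c l * fderiv ℝ (fun y => π y a b) x (coordVec m k l))

theorem aux_indep {m k : ℕ} (g : ((Fin m → ℝ) × (Fin k → ℝ)) → ℝ)
    (hg : Differentiable ℝ g) (hi : ∀ x c c', g (x, c) = g (x, c'))
    (x : (Fin m → ℝ) × (Fin k → ℝ)) (j : Fin k) :
    fderiv ℝ g x (coordVec m k (Sum.inr j)) = 0 := by
  set L : ((Fin m → ℝ) × (Fin k → ℝ)) →L[ℝ] ((Fin m → ℝ) × (Fin k → ℝ)) :=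
    (ContinuousLinearMap.fst ℝ _ _).prod 0 with hL
  have h1 : g = fun y => g (L y) := by
    funext y
    exact hi y.1 y.2 0
  have h2 : HasFDerivAt (fun y => g (L y)) ((fderiv ℝ g (L x)).comp L) x :=
    (hg (L x)).hasFDerivAt.comp x L.hasFDerivAt
  rw [← h1] at h2
  rw [h2.fderiv]
  have : L (coordVec m k (Sum.inr j)) = 0 := by
    simp [hL, coordVec]
  simp [this]

theorem aux_sum {ι : Type*} [Fintype ι] (p1 p2 p3 p4 p5 p6 d1 d2 d3 d4 d5 d6 : ℝ)
    (u1 u2 u3 u4 u5 u6 : ι → ℝ) :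
    p1 * (d1 + ∑ i, u1 i) + (d2 + ∑ i, u2 i) * p2 + p3 * (d3 + ∑ i, u3 i)
      + (d4 + ∑ i, u4 i) * p4 + p5 * (d5 + ∑ i, u5 i) + (d6 + ∑ i, u6 i) * p6
    = (p1 * d1 + d2 * p2 + p3 * d3 + d4 * p4 + p5 * d5 + d6 * p6)
      + ∑ i, (p1 * u1 i + u2 i * p2 + p3 * u3 i + u4 i * p4 + p5 * u5 i + u6 i * p6) := by
  simp only [Finset.sum_add_distrib, ← Finset.mul_sum, ← Finset.sum_mul]
  ring

theorem aux_ham {ι : Type*} [Fintype ι] (P : ι → ι → ℝ) (dP : ι → ι → ι → ℝ)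
    (F : ι → ℝ) (H : ι → ι → ℝ) (hH : ∀ l r, H l r = H r l)
    (hP : ∀ a b, P a b = - P b a) (hdP : ∀ l a b, dP l a b = - dP l b a)
    (hJ : ∀ a b c, ∑ l, (P a l * dP l b c + P b l * dP l c a + P c l * dP l a b) = 0)
    (a b : ι) :
    ∑ l, (P a l * (∑ r, (P b r * H l r + F r * dP l b r))
      - P b l * (∑ r, (P a r * H l r + F r * dP l a r))
      - (∑ r, P l r * F r) * dP l a b) = 0 := by
  have e1 : ∀ l, (P a l * (∑ r, (P b r * H l r + F r * dP l b r))
      - P b l * (∑ r, (P a r * H l r + F r * dP l a r))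
      - (∑ r, P l r * F r) * dP l a b)
      = (∑ r, P a l * P b r * H l r) - (∑ r, P b l * P a r * H l r)
        + ∑ r, F r * (P a l * dP l b r + P b l * dP l r a + P r l * dP l a b) := by
    intro l
    rw [Finset.mul_sum, Finset.mul_sum, Finset.sum_mul, ← Finset.sum_sub_distrib,
      ← Finset.sum_sub_distrib, ← Finset.sum_sub_distrib, ← Finset.sum_add_distrib]
    refine Finset.sum_congr rfl fun r _ => ?_
    rw [hP l r, hdP l a r]
    ring
  simp only [e1]
  rw [Finset.sum_add_distrib, Finset.sum_sub_distrib]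
  have e2 : ∑ l, ∑ r, P b l * P a r * H l r = ∑ l, ∑ r, P a l * P b r * H l r := by
    rw [Finset.sum_comm]
    refine Finset.sum_congr rfl fun l _ => Finset.sum_congr rfl fun r _ => ?_
    rw [hH]; ring
  have e3 : ∑ l, ∑ r, F r * (P a l * dP l b r + P b l * dP l r a + P r l * dP l a b) = 0 := by
    rw [Finset.sum_comm]
    refine Finset.sum_eq_zero fun r _ => ?_
    rw [← Finset.mul_sum, hJ, mul_zero]
  rw [e2, e3]; ring

/-- On `ℝ^{m+k}` with coordinates `(x, c)`, let `π₀` be a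
differentiable antisymmetric Poisson matrix field whose entries vanish on the last `k`
coordinates and which is independent of `c`, and let `π₁D` be a differentiable
antisymmetric matrix field compatible with `π₀`.  Let `f 1, …, f k` be twice
differentiable, `X i = π₀ · ∇ (f i)` the Hamiltonian vector fields, `Z i = ∂/∂c_i` the
constant coordinate vector fields, and `π₁ = π₁D + ∑ i (X i ⊗ Z i - Z i ⊗ X i)`.
Then `π₀` and `π₁` are compatible: `[π₀, π₁] = 0`. -/
theorem bihamiltonian_extension_compatibility
    {m k : ℕ} (hm : 1 ≤ m) (hk : 1 ≤ k)
    (π₀ π₁D : ((Fin m → ℝ) × (Fin k → ℝ)) → (Fin m ⊕ Fin k) → (Fin m ⊕ Fin k) → ℝ)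
    (hπ₀diff : ∀ a b, Differentiable ℝ (fun y => π₀ y a b))
    (hπ₀anti : ∀ y a b, π₀ y a b = -π₀ y b a)
    (hπ₀zero1 : ∀ y (j : Fin k) (a : Fin m ⊕ Fin k), π₀ y (Sum.inr j) a = 0)
    (hπ₀zero2 : ∀ y (j : Fin k) (a : Fin m ⊕ Fin k), π₀ y a (Sum.inr j) = 0)
    (hπ₀indep : ∀ (x : Fin m → ℝ) (c c' : Fin k → ℝ) a b, π₀ (x, c) a b = π₀ (x, c') a b)
    (hπ₀jac : ∀ x a b c, jacobiExpr π₀ x a b c = 0)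
    (hπ₁Ddiff : ∀ a b, Differentiable ℝ (fun y => π₁D y a b))
    (hπ₁Danti : ∀ y a b, π₁D y a b = -π₁D y b a)
    (hcompat : ∀ x a b c, schoutenBracket π₀ π₁D x a b c = 0)
    (f : Fin k → ((Fin m → ℝ) × (Fin k → ℝ)) → ℝ)
    (hf : ∀ i, ContDiff ℝ 2 (f i))
    (X : Fin k → ((Fin m → ℝ) × (Fin k → ℝ)) → (Fin m ⊕ Fin k) → ℝ)
    (hX : ∀ i y a, X i y a
      = ∑ b : Fin m ⊕ Fin k, π₀ y a b * fderiv ℝ (f i) y (coordVec m k b))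
    (Z : Fin k → (Fin m ⊕ Fin k) → ℝ)
    (hZ : ∀ i a, Z i a = if a = Sum.inr i then 1 else 0)
    (π₁ : ((Fin m → ℝ) × (Fin k → ℝ)) → (Fin m ⊕ Fin k) → (Fin m ⊕ Fin k) → ℝ)
    (hπ₁ : ∀ y a b, π₁ y a b = π₁D y a b + ∑ i, (X i y a * Z i b - Z i a * X i y b)) :
    ∀ x a b c, schoutenBracket π₀ π₁ x a b c = 0 := by
  intro x a b c
  have hsmooth : ∀ i, Differentiable ℝ (fderiv ℝ (f i)) := fun i =>
    ((hf i).fderiv_right (m := 1) (by norm_num)).differentiable (by norm_num)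
  have hXd : ∀ i a v, HasFDerivAt (fun y => X i y a)
      (∑ r, (π₀ x a r • (fderiv ℝ (fderiv ℝ (f i)) x).flip (coordVec m k r)
        + fderiv ℝ (f i) x (coordVec m k r) • fderiv ℝ (fun y => π₀ y a r) x)) x ∧
      fderiv ℝ (fun y => X i y a) x v
      = ∑ r, (π₀ x a r * fderiv ℝ (fderiv ℝ (f i)) x v (coordVec m k r)
        + fderiv ℝ (f i) x (coordVec m k r) * fderiv ℝ (fun y => π₀ y a r) x v) := by
    intro i a v
    have h : HasFDerivAt (fun y => X i y a)
      (∑ r, (π₀ x a r • (fderiv ℝ (fderiv ℝ (f i)) x).flip (coordVec m k r)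
        + fderiv ℝ (f i) x (coordVec m k r) • fderiv ℝ (fun y => π₀ y a r) x)) x := by
      have : (fun y => X i y a) = fun y => ∑ r, π₀ y a r * fderiv ℝ (f i) y (coordVec m k r) := by
        funext y; exact hX i y a
      rw [this]
      refine HasFDerivAt.fun_sum fun r _ => ?_
      refine ((hπ₀diff a r) x).hasFDerivAt.mul ?_
      have h2 := (hsmooth i x).hasFDerivAt.clm_apply (hasFDerivAt_const (coordVec m k r) x)
      simpa using h2
    refine ⟨h, ?_⟩
    rw [h.fderiv]
    simp
  have hsymm : ∀ i v w, fderiv ℝ (fderiv ℝ (f i)) x v w = fderiv ℝ (fderiv ℝ (f i)) x w v := by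
    intro i v w
    exact ((hf i).contDiffAt.isSymmSndFDerivAt (by simp)) v w
  have hdanti : ∀ l a b, fderiv ℝ (fun y => π₀ y a b) x (coordVec m k l)
      = - fderiv ℝ (fun y => π₀ y b a) x (coordVec m k l) := by
    intro l a b
    have : (fun y => π₀ y a b) = fun y => - π₀ y b a := by
      funext y; exact hπ₀anti y a b
    rw [this, fderiv_fun_neg]; rfl
  have hK : ∀ i a b, ∑ l, (π₀ x a l * fderiv ℝ (fun y => X i y b) x (coordVec m k l)
      - π₀ x b l * fderiv ℝ (fun y => X i y a) x (coordVec m k l)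
      - X i x l * fderiv ℝ (fun y => π₀ y a b) x (coordVec m k l)) = 0 := by
    intro i a b
    have := aux_ham (π₀ x) (fun l a b => fderiv ℝ (fun y => π₀ y a b) x (coordVec m k l))
      (fun r => fderiv ℝ (f i) x (coordVec m k r))
      (fun l r => fderiv ℝ (fderiv ℝ (f i)) x (coordVec m k l) (coordVec m k r))
      (fun l r => hsymm i _ _) (hπ₀anti x) hdanti (hπ₀jac x) a b
    rw [← this]
    refine Finset.sum_congr rfl fun l _ => ?_
    rw [(hXd i b _).2, (hXd i a _).2, hX i x l]
  have hW : ∀ i b c, ∑ l, Z i l * fderiv ℝ (fun y => π₀ y b c) x (coordVec m k l) = 0 := by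
    intro i b c
    refine Finset.sum_eq_zero fun l _ => ?_
    rw [hZ]
    split_ifs with h
    · rw [h, aux_indep _ (hπ₀diff b c) (fun x c1 c2 => hπ₀indep x c1 c2 b c), mul_zero]
    · rw [zero_mul]
  have hd : ∀ b c v, fderiv ℝ (fun y => π₁ y b c) x v = fderiv ℝ (fun y => π₁D y b c) x v
      + ∑ i, (fderiv ℝ (fun y => X i y b) x v * Z i c
        - Z i b * fderiv ℝ (fun y => X i y c) x v) := by
    intro b c v
    have h0 : (fun y => π₁ y b c) = fun y => π₁D y b c
        + ∑ i, (X i y b * Z i c - Z i b * X i y c) := by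
      funext y; exact hπ₁ y b c
    have hx : ∀ i a, HasFDerivAt (fun y => X i y a) (fderiv ℝ (fun y => X i y a) x) x :=
      fun i a => (hXd i a 0).1.differentiableAt.hasFDerivAt
    have h := ((hπ₁Ddiff b c) x).hasFDerivAt.add (HasFDerivAt.fun_sum (u := Finset.univ)
      fun i _ => ((hx i b).mul_const (Z i c)).sub ((hx i c).const_mul (Z i b)))
    rw [h0]
    refine (DFunLike.congr_fun h.fderiv v).trans ?_
    simp [mul_comm]
  have hmain : schoutenBracket π₀ π₁ x a b c = schoutenBracket π₀ π₁D x a b c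
      + ∑ i, (Z i c * 0 + Z i a * 0 + Z i b * 0 + X i x a * 0 + X i x b * 0 + X i x c * 0) := by
    have e : ∀ i, (Z i c * 0 + Z i a * 0 + Z i b * 0 + X i x a * 0 + X i x b * 0 + X i x c * 0)
      = Z i c * (∑ l, (π₀ x a l * fderiv ℝ (fun y => X i y b) x (coordVec m k l)
          - π₀ x b l * fderiv ℝ (fun y => X i y a) x (coordVec m k l)
          - X i x l * fderiv ℝ (fun y => π₀ y a b) x (coordVec m k l)))
        + Z i a * (∑ l, (π₀ x b l * fderiv ℝ (fun y => X i y c) x (coordVec m k l)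
          - π₀ x c l * fderiv ℝ (fun y => X i y b) x (coordVec m k l)
          - X i x l * fderiv ℝ (fun y => π₀ y b c) x (coordVec m k l)))
        + Z i b * (∑ l, (π₀ x c l * fderiv ℝ (fun y => X i y a) x (coordVec m k l)
          - π₀ x a l * fderiv ℝ (fun y => X i y c) x (coordVec m k l)
          - X i x l * fderiv ℝ (fun y => π₀ y c a) x (coordVec m k l)))
        + X i x a * (∑ l, Z i l * fderiv ℝ (fun y => π₀ y b c) x (coordVec m k l))
        + X i x b * (∑ l, Z i l * fderiv ℝ (fun y => π₀ y c a) x (coordVec m k l))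
        + X i x c * (∑ l, Z i l * fderiv ℝ (fun y => π₀ y a b) x (coordVec m k l)) := by
      intro i
      rw [hK, hK, hK, hW, hW, hW]
    simp only [e]
    simp only [Finset.mul_sum, ← Finset.sum_add_distrib]
    rw [Finset.sum_comm]
    unfold schoutenBracket
    rw [← Finset.sum_add_distrib]
    refine Finset.sum_congr rfl fun l _ => ?_
    rw [hd, hd, hd, hπ₁ x a l, hπ₁ x b l, hπ₁ x c l, aux_sum]
    congr 1
    refine Finset.sum_congr rfl fun i _ => ?_
    ring
  rw [hmain, hcompat]
  simp
end

section
/- Let R be a commutative ring, n ≥ 1, k ≥ 1, and fix integers 1 < n_1 < ⋯ < n_k < n+k. Let ρ_0 = 1, ρ_1, …, ρ_n ∈ R, with the conventions ρ_j := 0 for j < 0 and j > n, and let V_r^{(m)} be the basic separable potentials. Set H_j := 0 for j ≤ 0. Suppose H_1, …, H_n ∈ R and H̃_1, …, H̃_{n+k} ∈ R satisfy H̃_{n_i} = 0 for i = 1,…,k and the deformation relations H_r = H̃_{r+k} − Σ_{i=1}^{k} V_r^{(n+k−i)} H̃_i for r = 1,…,n. Let φ := det[(ρ_{n_i−j})_{1≤i,j≤k}].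 Then for every r = 1,…,n+k: φ·H̃_r equals the determinant of the (k+1)×(k+1) matrix whose first row is (H_{r−k}, ρ_{r−1}, ρ_{r−2}, …, ρ_{r−k}) and whose (i+1)-th row is (H_{n_i−k}, ρ_{n_i−1}, ρ_{n_i−2}, …, ρ_{n_i−k}) for i = 1,…,k. -/
/-- base values of the potentials below degree `n` -/
lemma V_low {R : Type*} [CommRing R] {n : ℕ} (ρ : ℤ → R) (V : ℕ → ℕ → R)
    (hV0 : ∀ r ∈ Finset.Icc 1 n, V 0 r = -(if r = n then 1 else 0))
    (hVtop : ∀ m, V m (n + 1) = 0)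
    (hVrec : ∀ m, ∀ r ∈ Finset.Icc 1 n, V (m + 1) r = V m (r + 1) - ρ (r : ℤ) * V m 1)
    (m : ℕ) : m < n → ∀ r, 1 ≤ r → r ≤ n → V m r = -(if r + m = n then 1 else 0) := by
  induction m with
  | zero =>
    intro _ r h1 h2
    simpa using hV0 r (Finset.mem_Icc.2 ⟨h1, h2⟩)
  | succ m ih =>
    intro hm r h1 h2
    rw [hVrec m r (Finset.mem_Icc.2 ⟨h1, h2⟩), ih (by omega) 1 le_rfl (by omega),
      if_neg (by omega : ¬ 1 + m = n)]
    by_cases h : r = n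
    · subst h
      rw [hVtop, if_neg (by omega)]; simp
    · rw [ih (by omega) (r + 1) (by omega) (by omega)]
      have : (r + 1 + m = n) ↔ (r + (m + 1) = n) := by omega
      simp [this]

lemma V_high {R : Type*} [CommRing R] {n : ℕ} (hn : 1 ≤ n) (ρ : ℤ → R)
    (hρtop : ∀ j : ℤ, (n : ℤ) < j → ρ j = 0) (V : ℕ → ℕ → R)
    (hV0 : ∀ r ∈ Finset.Icc 1 n, V 0 r = -(if r = n then 1 else 0))
    (hVtop : ∀ m, V m (n + 1) = 0)
    (hVrec : ∀ m, ∀ r ∈ Finset.Icc 1 n, V (m + 1) r = V m (r + 1) - ρ (r : ℤ) * V m 1)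
    (s : ℕ) : ∀ r, 1 ≤ r → r ≤ n + 1 → V (n - 1 + s) r =
      ∑ j ∈ Finset.range s, (-V (n - 1 + j) 1) * ρ ((r : ℤ) + s - 1 - j)
        - (if s = 0 ∧ r = 1 then 1 else 0) := by
  induction s with
  | zero =>
    intro r h1 h2
    by_cases h : r = n + 1
    · subst h
      rw [hVtop, if_neg (by omega)]; simp
    · rw [add_zero, V_low ρ V hV0 hVtop hVrec (n - 1) (by omega) r h1 (by omega)]
      have : (r + (n - 1) = n) ↔ r = 1 := by omega
      simp [this]
  | succ s ih =>
    intro r h1 h2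
    rw [if_neg (by omega)]
    by_cases h : r = n + 1
    · subst h
      rw [hVtop, Finset.sum_eq_zero]
      · simp
      · intro j hj
        rw [Finset.mem_range] at hj
        rw [hρtop _ (by push_cast; omega), mul_zero]
    · rw [← add_assoc, hVrec _ r (Finset.mem_Icc.2 ⟨h1, by omega⟩), ih (r + 1) (by omega) (by omega),
        if_neg (by omega), Finset.sum_range_succ]
      have e : (r : ℤ) + (s + 1 : ℕ) - 1 - s = r := by push_cast; ring
      rw [e]
      have : ∀ j : ℕ, ((r + 1 : ℕ) : ℤ) + s - 1 - j = (r : ℤ) + (s + 1 : ℕ) - 1 - j := by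
        intro j; push_cast; ring
      simp only [this]
      ring

/-- the inverse series identity -/
lemma W_inv {R : Type*} [CommRing R] {n : ℕ} (hn : 1 ≤ n) (ρ : ℤ → R)
    (hρ0 : ρ 0 = 1) (hρneg : ∀ j : ℤ, j < 0 → ρ j = 0)
    (hρtop : ∀ j : ℤ, (n : ℤ) < j → ρ j = 0) (V : ℕ → ℕ → R)
    (hV0 : ∀ r ∈ Finset.Icc 1 n, V 0 r = -(if r = n then 1 else 0))
    (hVtop : ∀ m, V m (n + 1) = 0)
    (hVrec : ∀ m, ∀ r ∈ Finset.Icc 1 n, V (m + 1) r = V m (r + 1) - ρ (r : ℤ) * V m 1)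
    (a : ℕ) (t : ℤ) (hta : t < a) :
      ∑ j ∈ Finset.range a, (-V (n - 1 + j) 1) * ρ (t - j) = if t = 0 then 1 else 0 := by
  by_cases ht : t < 0
  · rw [if_neg (by omega)]
    apply Finset.sum_eq_zero
    intro j _
    rw [hρneg _ (by omega), mul_zero]
  · obtain ⟨u, rfl⟩ := Int.eq_ofNat_of_zero_le (not_lt.1 ht)
    have hsub : Finset.range (u + 1) ⊆ Finset.range a := by
      intro x; simp only [Finset.mem_range]; omega
    rw [← Finset.sum_subset hsub]
    · have := V_high hn ρ hρtop V hV0 hVtop hVrec u 1 le_rfl (by omega)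
      rw [Finset.sum_range_succ, sub_self, hρ0]
      have e : ∀ j : ℕ, ((1 : ℕ) : ℤ) + u - 1 - j = (u : ℤ) - j := by
        intro j; push_cast; ring
      simp only [e] at this
      rw [mul_one, this]
      by_cases hu : u = 0 <;> simp [hu]
    · intro j _ hj
      rw [Finset.mem_range] at hj
      rw [hρneg _ (by omega), mul_zero]

lemma exists_c {R : Type*} [CommRing R] {n k : ℕ} (hn : 1 ≤ n)
    (ρ : ℤ → R) (hρ0 : ρ 0 = 1) (hρneg : ∀ j : ℤ, j < 0 → ρ j = 0)
    (hρtop : ∀ j : ℤ, (n : ℤ) < j → ρ j = 0)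
    (V : ℕ → ℕ → R)
    (hV0 : ∀ r ∈ Finset.Icc 1 n, V 0 r = -(if r = n then 1 else 0))
    (hVtop : ∀ m, V m (n + 1) = 0)
    (hVrec : ∀ m, ∀ r ∈ Finset.Icc 1 n, V (m + 1) r = V m (r + 1) - ρ (r : ℤ) * V m 1)
    (H : ℤ → R) (hHneg : ∀ j : ℤ, j ≤ 0 → H j = 0)
    (Ht : ℕ → R)
    (hdef : ∀ r, 1 ≤ r → r ≤ n →
      H (r : ℤ) = Ht (r + k) - ∑ i ∈ Finset.Icc 1 k, V (n + k - i) r * Ht i) :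
    ∃ c : ℕ → R, ∀ r : ℕ, 1 ≤ r → r ≤ n + k →
      Ht r = H ((r : ℤ) - k) + ∑ l ∈ Finset.Icc 1 k, c l * ρ ((r : ℤ) - l) := by
  refine ⟨fun l => ∑ i ∈ Finset.Icc 1 k, if i ≤ l then Ht i * (-V (n - 1 + (l - i)) 1) else 0, ?_⟩
  intro r h1 h2
  have key : ∑ l ∈ Finset.Icc 1 k, (∑ i ∈ Finset.Icc 1 k,
      if i ≤ l then Ht i * (-V (n - 1 + (l - i)) 1) else 0) * ρ ((r : ℤ) - l) =
      ∑ i ∈ Finset.Icc 1 k, Ht i * ∑ j ∈ Finset.range (k + 1 - i),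
        (-V (n - 1 + j) 1) * ρ (((r : ℤ) - i) - j) := by
    simp only [Finset.sum_mul]
    rw [Finset.sum_comm]
    apply Finset.sum_congr rfl
    intro i hi
    rw [Finset.mem_Icc] at hi
    simp only [ite_mul, zero_mul]
    rw [← Finset.sum_filter, Finset.mul_sum]
    refine Finset.sum_bij' (fun l _ => l - i) (fun j _ => j + i) ?_ ?_ ?_ ?_ ?_
    · intro l hl; simp only [Finset.mem_filter, Finset.mem_Icc, Finset.mem_range] at *; omega
    · intro l hl; simp only [Finset.mem_filter, Finset.mem_Icc, Finset.mem_range] at *; omega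
    · intro l hl; simp only [Finset.mem_filter, Finset.mem_Icc] at *; omega
    · intro l hl; omega
    · intro l hl
      simp only [Finset.mem_filter, Finset.mem_Icc] at hl
      have : (r : ℤ) - i - (l - i : ℕ) = r - l := by omega
      rw [this, mul_assoc]
  rw [key]
  by_cases hr : r ≤ k
  · rw [hHneg _ (by omega), zero_add, Finset.sum_eq_single r]
    · rw [W_inv hn ρ hρ0 hρneg hρtop V hV0 hVtop hVrec _ _ (by omega)]
      simp
    · intro i hi hir
      rw [Finset.mem_Icc] at hi
      rw [W_inv hn ρ hρ0 hρneg hρtop V hV0 hVtop hVrec _ _ (by omega), if_neg (by omega), mul_zero]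
    · intro h
      exact absurd (Finset.mem_Icc.2 ⟨h1, hr⟩) h
  · obtain ⟨q, rfl⟩ : ∃ q, r = q + k := ⟨r - k, by omega⟩
    have e : ((q + k : ℕ) : ℤ) - k = q := by push_cast; ring
    rw [e, hdef q (by omega) (by omega)]
    have : ∀ i ∈ Finset.Icc 1 k, Ht i * ∑ j ∈ Finset.range (k + 1 - i),
        (-V (n - 1 + j) 1) * ρ ((((q + k : ℕ) : ℤ) - i) - j) = V (n + k - i) q * Ht i := by
      intro i hi
      rw [Finset.mem_Icc] at hi
      have := V_high hn ρ hρtop V hV0 hVtop hVrec (k + 1 - i) q (by omega) (by omega)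
      rw [if_neg (by omega), sub_zero, (by omega : n - 1 + (k + 1 - i) = n + k - i)] at this
      have e : ∀ j : ℕ, (q : ℤ) + (k + 1 - i : ℕ) - 1 - j = (((q + k : ℕ) : ℤ) - i) - j := by
        intro j; omega
      simp only [e] at this
      rw [this, mul_comm]
    rw [Finset.sum_congr rfl this]
    ring

/-- Let `R` be a commutative ring, `1 < ns 1 < ⋯ < ns k < n+k`,
`ρ 0 = 1, ρ 1, …, ρ n ∈ R` with `ρ j = 0` for `j < 0` and `j > n`, and let `V m r`
(`= V_r^{(m)}`) be the basic separable potentials.  Suppose `H 1, …, H n` and the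
`k`-hole deformed Hamiltonians `Ht 1, …, Ht (n+k)` (with `Ht (ns i) = 0` for
`i = 1, …, k` and `H j = 0` for `j ≤ 0`) satisfy the deformation relations
`H r = Ht (r+k) - ∑_{i=1}^{k} V (n+k-i) r * Ht i` for `r = 1, …, n`.  Let
`φ = det (ρ (ns i - j))_{1 ≤ i,j ≤ k}`.  Then for every `r = 1, …, n+k`, `φ * Ht r`
equals the determinant of the `(k+1) × (k+1)` matrix whose first row is
`(H (r-k), ρ (r-1), …, ρ (r-k))` and whose `(i+1)`-th row is
`(H (ns i - k), ρ (ns i - 1), …, ρ (ns i - k))` for `i = 1, …, k`. -/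
theorem k_hole_deformed_hamiltonians_determinant_formula
    {R : Type*} [CommRing R] {n k : ℕ} (hn : 1 ≤ n) (hk : 1 ≤ k)
    (ns : ℕ → ℕ) (hns1 : 1 < ns 1)
    (hnsmono : ∀ i, 1 ≤ i → i < k → ns i < ns (i + 1)) (hnstop : ns k < n + k)
    (ρ : ℤ → R) (hρ0 : ρ 0 = 1) (hρneg : ∀ j : ℤ, j < 0 → ρ j = 0)
    (hρtop : ∀ j : ℤ, (n : ℤ) < j → ρ j = 0)
    (V : ℕ → ℕ → R)
    (hV0 : ∀ r ∈ Finset.Icc 1 n, V 0 r = -(if r = n then 1 else 0))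
    (hVtop : ∀ m, V m (n + 1) = 0)
    (hVrec : ∀ m, ∀ r ∈ Finset.Icc 1 n, V (m + 1) r = V m (r + 1) - ρ (r : ℤ) * V m 1)
    (H : ℤ → R) (hHneg : ∀ j : ℤ, j ≤ 0 → H j = 0)
    (Ht : ℕ → R) (hHthole : ∀ i, 1 ≤ i → i ≤ k → Ht (ns i) = 0)
    (hdef : ∀ r, 1 ≤ r → r ≤ n →
      H (r : ℤ) = Ht (r + k) - ∑ i ∈ Finset.Icc 1 k, V (n + k - i) r * Ht i)
    (φ : R)
    (hφ : φ = Matrix.det (Matrix.of fun i j : Fin k =>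
      ρ ((ns ((i : ℕ) + 1) : ℤ) - ((j : ℕ) + 1)))) :
    ∀ r, 1 ≤ r → r ≤ n + k →
      φ * Ht r = Matrix.det (Matrix.of fun a b : Fin (k + 1) =>
        if (b : ℕ) = 0 then
          H ((if (a : ℕ) = 0 then (r : ℤ) else (ns (a : ℕ) : ℤ)) - (k : ℤ))
        else
          ρ ((if (a : ℕ) = 0 then (r : ℤ) else (ns (a : ℕ) : ℤ)) - ((b : ℕ) : ℤ))) := by
  intro r h1 h2
  obtain ⟨c, hc⟩ := exists_c (k := k) hn ρ hρ0 hρneg hρtop V hV0 hVtop hVrec H hHneg Ht hdef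
  have hlow : ∀ i, 1 ≤ i → i ≤ k → 1 < ns i := by
    intro i hi
    induction i, hi using Nat.le_induction with
    | base => intro _; exact hns1
    | succ i hi ih =>
      intro h
      exact lt_trans (ih (by omega)) (hnsmono i hi (by omega))
  have hhigh : ∀ d i, 1 ≤ i → i + d = k → ns i < n + k := by
    intro d
    induction d with
    | zero => intro i _ h; obtain rfl : i = k := by omega
              exact hnstop
    | succ d ih =>
      intro i hi h
      exact lt_trans (hnsmono i hi (by omega)) (ih (i + 1) (by omega) (by omega))
  set M : Matrix (Fin (k + 1)) (Fin (k + 1)) R := Matrix.of fun a b : Fin (k + 1) =>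
        if (b : ℕ) = 0 then
          H ((if (a : ℕ) = 0 then (r : ℤ) else (ns (a : ℕ) : ℤ)) - (k : ℤ))
        else
          ρ ((if (a : ℕ) = 0 then (r : ℤ) else (ns (a : ℕ) : ℤ)) - ((b : ℕ) : ℤ)) with hM
  have hdet := Matrix.det_updateCol_sum M 0 (fun b => if (b : ℕ) = 0 then 1 else c b)
  have hcol : ∀ a : Fin (k + 1), ∑ b : Fin (k + 1), (if (b : ℕ) = 0 then 1 else c b) • M a b
      = if a = 0 then Ht r else 0 := by
    intro a
    have hs : ∀ f : ℕ → R, ∑ l ∈ Finset.Icc 1 k, f l = ∑ b : Fin k, f (b + 1) := by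
      intro f
      rw [Fin.sum_univ_eq_sum_range (fun b => f (b + 1)) k, Finset.range_eq_Ico,
        Finset.sum_Ico_add' f 0 k 1]
      rfl
    rw [Fin.sum_univ_succ]
    induction a using Fin.cases with
    | zero =>
      rw [if_pos rfl, hc r h1 h2, hs]
      simp [hM]
    | succ a =>
      rw [if_neg (Fin.succ_ne_zero a), ← hHthole (a + 1) (by omega) (by omega),
        hc (ns (a + 1)) (hlow _ (by omega) (by omega)).le
          (hhigh (k - (a + 1)) (a + 1) (by omega) (by omega)).le, hs]
      simp [hM]
  simp only [hcol] at hdet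
  rw [Fin.val_zero, if_pos rfl, one_smul] at hdet
  rw [← hdet, Matrix.det_succ_column_zero, Fin.sum_univ_succ, Finset.sum_eq_zero, add_zero, hφ]
  · simp only [Matrix.updateCol_self, if_pos, Fin.val_zero, pow_zero, one_mul]
    rw [mul_comm]
    congr 2
  · intro i _
    simp [Matrix.updateCol_self]
end

section
/- Let S be a commutative ring, ℓ ∈ S, and ρ_0 = 1, ρ_1, …, ρ_n ∈ S with the conventions ρ_j := 0 for j < 0 and j > n. Define K_r := Σ_{j=0}^{r−1} ρ_j ℓ^{r−1−j} for r ≥ 1 and K_r := 0 for r ≤ 0. Then for any k ≥ 1 and any integers r, n_1, …, n_k, the two (k+1)×(k+1) determinants with rows indexed by a ∈ {r, n_1, …, n_k} agree: det of the matrix with a-th row (K_{a−k}, ρ_{a−1}, ρ_{a−2}, …, ρ_{a−k}) equals det of the matrix with a-th row (K_{a−k}, K_a, K_{a−1}, …, K_{a−k+1}). (This is the column-replacement identity used to express the k-hole deformed geodesic Hamiltonians Ẽ_r in terms of products of the Killing tensors K_r alone.) -/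
/-- Let `S` be a commutative ring, `ℓ ∈ S`, `ρ 0 = 1, ρ 1, …, ρ n ∈ S`
extended by `ρ j = 0` for `j < 0` and `j > n`, and `K r = ∑_{j=0}^{r-1} ρ j * ℓ^(r-1-j)`
for `r ≥ 1`, `K r = 0` for `r ≤ 0`.  Then for any `k ≥ 1` and any integers
`r, n₁, …, n_k` (encoded as `idx : Fin (k+1) → ℤ`), the two `(k+1) × (k+1)`
determinants with rows indexed by `a ∈ {r, n₁, …, n_k}` agree: the determinant of the
matrix with `a`-th row `(K (a-k), ρ (a-1), ρ (a-2), …, ρ (a-k))` equals that of the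
matrix with `a`-th row `(K (a-k), K a, K (a-1), …, K (a-k+1))`.  (This is the
column-replacement identity used for the `k`-hole deformed geodesic Hamiltonians.) -/
theorem killing_tensor_determinant_column_replacement
    {S : Type*} [CommRing S] {n : ℕ} (ℓ : S)
    (ρ : ℤ → S) (hρ0 : ρ 0 = 1) (hρneg : ∀ j : ℤ, j < 0 → ρ j = 0)
    (hρtop : ∀ j : ℤ, (n : ℤ) < j → ρ j = 0)
    (K : ℤ → S)
    (hKpos : ∀ r : ℤ, 1 ≤ r →
      K r = ∑ j ∈ Finset.range r.toNat, ρ (j : ℤ) * ℓ ^ (r.toNat - 1 - j))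
    (hKneg : ∀ r : ℤ, r ≤ 0 → K r = 0)
    (k : ℕ) (hk : 1 ≤ k) (idx : Fin (k + 1) → ℤ) :
    Matrix.det (Matrix.of fun a b : Fin (k + 1) =>
        if (b : ℕ) = 0 then K (idx a - (k : ℤ)) else ρ (idx a - ((b : ℕ) : ℤ)))
      = Matrix.det (Matrix.of fun a b : Fin (k + 1) =>
        if (b : ℕ) = 0 then K (idx a - (k : ℤ)) else K (idx a - ((b : ℕ) : ℤ) + 1)) := by
  have hrec : ∀ r : ℤ, K (r + 1) = ρ r + ℓ * K r := by
    intro r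
    rcases lt_trichotomy r 0 with h | h | h
    · rw [hKneg _ (by omega), hKneg _ (by omega), hρneg _ h]; simp
    · subst h
      rw [hKpos _ (by omega), hKneg 0 le_rfl]; simp
    · obtain ⟨m, rfl⟩ : ∃ m : ℕ, r = (m : ℤ) + 1 := ⟨(r - 1).toNat, by omega⟩
      rw [hKpos _ (by omega), hKpos _ (by omega)]
      have e1 : ((m : ℤ) + 1 + 1).toNat = m + 2 := by omega
      have e2 : ((m : ℤ) + 1).toNat = m + 1 := by omega
      rw [e1, e2, Finset.sum_range_succ, Finset.mul_sum, add_comm]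
      congr 1
      · simp
      · refine Finset.sum_congr rfl fun j hj => ?_
        rw [Finset.mem_range] at hj
        have : m + 2 - 1 - j = (m + 1 - 1 - j) + 1 := by omega
        rw [this, pow_succ]; ring
  have hneg : ∀ j : Fin k, ((-j.succ : Fin (k + 1)) : ℕ) = k - j := by
    intro j
    rw [Fin.val_neg', Fin.val_succ, Nat.mod_eq_of_lt (by omega)]
    omega
  have key : ∀ M N : Matrix (Fin (k + 1)) (Fin (k + 1)) S,
      (M.submatrix id (Equiv.neg (Fin (k + 1)))).det
        = (N.submatrix id (Equiv.neg (Fin (k + 1)))).det → M.det = N.det := by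
    intro M N h
    rw [Matrix.det_permute', Matrix.det_permute'] at h
    rcases Int.units_eq_one_or (Equiv.Perm.sign (Equiv.neg (Fin (k + 1)))) with e | e <;>
      simpa [e] using h
  apply key
  symm
  refine Matrix.det_eq_of_forall_col_eq_smul_add_pred (fun _ => ℓ) ?_ ?_
  · intro i
    simp
  · intro i j
    have hj := j.2
    simp only [Matrix.submatrix_apply, Matrix.of_apply, id, Equiv.neg_apply, hneg]
    rw [if_neg (by omega), if_neg (by omega), hrec]
    congr 2
    by_cases h0 : (j : ℕ) = 0
    · have : j.castSucc = 0 := Fin.ext (by simpa using h0)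
      rw [this]; simp [h0]
    · have hv : ((-j.castSucc : Fin (k + 1)) : ℕ) = k + 1 - j := by
        rw [Fin.val_neg', Fin.val_castSucc, Nat.mod_eq_of_lt (by omega)]
      rw [hv, if_neg (by omega)]
      congr 1
      omega
end
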